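/- arXiv:1106.5089 — 2 statements merged into one kernel-verified Lean document; each statement's English description precedes it below -/
import Mathlib

section
/- Let Y be a closed subspace of the Banach space X via the isometric embedding j. If there exists a bounded linear extension operator Φ : B(Y) → B(X) between the spaces of continuous bilinear forms (i.e., Φ(φ)(jy₁, jy₂) = φ(y₁, y₂) for all φ ∈ B(Y) and y₁, y₂ ∈ Y), then Y is locally complemented in X: there is λ > 0 such that every finite-dimensional subspace F of X admits r_F : F → Y with ‖r_F‖ ≤ λ and r_F(j y) = y whenever j y ∈ F. -/
open Metric in
/-- An operator is controlled by its values on a `1/2`-net of the unit ball. -/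
theorem ContinuousLinearMap.opNorm_le_of_half_net {V W : Type*} [NormedAddCommGroup V]
    [NormedSpace ℝ V] [NormedAddCommGroup W] [NormedSpace ℝ W] (r : V →L[ℝ] W) {t : Set V} {C : ℝ}
    (hC : 0 ≤ C) (hcover : closedBall (0 : V) 1 ⊆ ⋃ x ∈ t, ball x (1 / 2))
    (hr : ∀ x ∈ t, ‖r x‖ ≤ C) : ‖r‖ ≤ 2 * C := by
  have key : ‖r‖ ≤ C + ‖r‖ * (1 / 2) := by
    refine r.opNorm_le_of_unit_norm (by positivity) fun z hz => ?_
    obtain ⟨x, hxt, hx⟩ := Set.mem_iUnion₂.1 (hcover (mem_closedBall_zero_iff.2 hz.le))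
    calc ‖r z‖ = ‖r x + r (z - x)‖ := by rw [← map_add, add_sub_cancel]
      _ ≤ ‖r x‖ + ‖r (z - x)‖ := norm_add_le _ _
      _ ≤ C + ‖r‖ * (1 / 2) :=
        add_le_add (hr x hxt) (r.le_opNorm_of_le (mem_ball_iff_norm.1 hx).le)
  linarith

/-- A linear functional bounded below on a submodule vanishes there. -/
theorem LinearMap.eq_zero_of_forall_le {V : Type*} [AddCommGroup V] [Module ℝ V] (f : V →ₗ[ℝ] ℝ)
    {u : ℝ} (W : Submodule ℝ V) (h : ∀ w ∈ W, u ≤ f w) {w : V} (hw : w ∈ W) : f w = 0 := by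
  by_contra hne
  have := h (((u - 1) / f w) • w) (W.smul_mem _ hw)
  rw [map_smul, smul_eq_mul, div_mul_cancel₀ _ hne] at this
  linarith

theorem StrongDual.exists_norm_lt_mul_norm_le {Y : Type*} [NormedAddCommGroup Y] [NormedSpace ℝ Y]
    (g : StrongDual ℝ Y) {C D : ℝ} (hC : 0 ≤ C) (hCD : C < D) :
    ∃ v : Y, ‖v‖ < D ∧ C * ‖g‖ ≤ g v := by
  have hD : 0 < D := hC.trans_lt hCD
  rcases eq_or_ne g 0 with rfl | hg
  · exact ⟨0, by simpa using hD, by simp⟩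
  have hlt : C / D * ‖g‖ < ‖g‖ :=
    mul_lt_of_lt_one_left (norm_pos_iff.2 hg) ((div_lt_one hD).2 hCD)
  obtain ⟨z, hz, hgz⟩ := g.exists_lt_apply_of_lt_opNorm hlt
  have hval : C * ‖g‖ ≤ D * ‖g z‖ := by
    calc C * ‖g‖ = D * (C / D * ‖g‖) := by field_simp
      _ ≤ _ := by gcongr
  have hnorm : ‖D • z‖ < D := by
    rw [norm_smul, Real.norm_of_nonneg hD.le]
    exact mul_lt_of_lt_one_right hD hz
  rcases le_total 0 (g z) with h | h
  · exact ⟨D • z, hnorm, by simpa [abs_of_nonneg h] using hval⟩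
  · exact ⟨-(D • z), by rwa [norm_neg], by simpa [abs_of_nonpos h] using hval⟩

section LinearExtension

variable {Y X : Type*} [NormedAddCommGroup Y] [NormedSpace ℝ Y]
  [NormedAddCommGroup X] [NormedSpace ℝ X]

/-- Helly-type step: given a linear extension operator for functionals, a linear map `T₀` into `Y`
can be corrected through `x ↦ x - q x` so as to be bounded on any finite subset of the unit ball. -/
theorem exists_linearMap_norm_lt_of_dual_extension (j : Y →L[ℝ] X)
    (E : StrongDual ℝ Y →L[ℝ] StrongDual ℝ X) (hE : ∀ f y, E f (j y) = f y)
    (F : Submodule ℝ X) [FiniteDimensional ℝ F] (q : F →ₗ[ℝ] F) (T₀ : F →ₗ[ℝ] Y)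
    (hT₀ : ∀ x, j (T₀ x) = q x) {ι : Type*} [Fintype ι] (x : ι → F) (hx : ∀ k, ‖x k‖ ≤ 1) :
    ∃ S : F →ₗ[ℝ] Y, ∀ k, ‖T₀ (x k) + S (x k - q (x k))‖ < ‖E‖ + 1 := by
  classical
  let w : (F →ₗ[ℝ] Y) →ₗ[ℝ] (ι → Y) :=
    LinearMap.pi fun k => LinearMap.applyₗ (x k - q (x k))
  let c : ι → Y := fun k => T₀ (x k)
  by_contra! hcon
  have hdisj : Disjoint (Metric.ball c (‖E‖ + 1)) (LinearMap.range w : Set (ι → Y)) := by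
    rw [Set.disjoint_left]
    rintro _ hmem ⟨S, rfl⟩
    obtain ⟨k, hk⟩ := hcon (-S)
    rw [mem_ball_iff_norm', pi_norm_lt_iff (by positivity)] at hmem
    refine (hmem k).not_ge ?_
    simpa [c, w, sub_eq_add_neg] using hk
  obtain ⟨f, u, hlt, hle⟩ := geometric_hahn_banach_open (convex_ball c (‖E‖ + 1))
    Metric.isOpen_ball (LinearMap.range w).convex hdisj
  have hzero : ∀ S, f (w S) = 0 := fun S =>
    LinearMap.eq_zero_of_forall_le (f : (ι → Y) →ₗ[ℝ] ℝ) (LinearMap.range w) hle ⟨S, rfl⟩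
  have hu : u ≤ 0 := by simpa using hle 0 (zero_mem _)
  let g : ι → StrongDual ℝ Y := fun k => f.comp (ContinuousLinearMap.single ℝ (fun _ => Y) k)
  have hf : ∀ v, f v = ∑ k, g k (v k) := fun v => by
    conv_lhs => rw [← Finset.univ_sum_single v, map_sum]
    rfl
  let b := Module.finBasis ℝ F
  have hg : ∀ i, ∑ k, b.repr (x k - q (x k)) i • g k = 0 := by
    intro i
    ext y
    have := hzero ((b.coord i).smulRight y)
    rw [hf] at this
    simpa [w, sub_mul] using this
  have hann : ∑ k, E (g k) ((x k - q (x k) : F) : X) = 0 := by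
    have hexp : ∀ k, E (g k) ((x k - q (x k) : F) : X) =
        ∑ i, b.repr (x k - q (x k)) i • E (g k) (b i : X) := by
      intro k
      conv_lhs => rw [← b.sum_repr (x k - q (x k))]
      simp only [Submodule.coe_sum, Submodule.coe_smul, map_sum, map_smul]
    simp_rw [hexp]
    rw [Finset.sum_comm]
    refine Finset.sum_eq_zero fun i _ => ?_
    have := congrArg (fun h => E h (b i : X)) (hg i)
    simpa only [map_sum, map_smul, sum_apply, smul_apply, map_zero, zero_apply] using this
  have hfc : f c = ∑ k, E (g k) (x k : X) := by
    rw [hf, ← sub_eq_zero, ← neg_eq_zero, neg_sub, ← Finset.sum_sub_distrib, ← hann]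
    refine Finset.sum_congr rfl fun k _ => ?_
    rw [Submodule.coe_sub, map_sub, ← hT₀, hE]
  choose v hv hgv using fun k => (g k).exists_norm_lt_mul_norm_le (norm_nonneg E) (lt_add_one ‖E‖)
  have hneg : f (c + v) < u := hlt _ (by
    rw [mem_ball_iff_norm, add_sub_cancel_left, pi_norm_lt_iff (by positivity)]
    exact hv)
  have hpos : 0 ≤ f (c + v) := by
    rw [map_add, hfc, hf v, ← Finset.sum_add_distrib]
    refine Finset.sum_nonneg fun k _ => ?_
    have h1 : ‖E (g k) (x k : X)‖ ≤ ‖E‖ * ‖g k‖ :=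
      calc ‖E (g k) (x k : X)‖ ≤ ‖E (g k)‖ * 1 := (E (g k)).le_opNorm_of_le (hx k)
        _ ≤ ‖E‖ * ‖g k‖ := by rw [mul_one]; exact E.le_opNorm _
    linarith [(abs_le.1 h1).1, hgv k]
  linarith

/-- A bounded linear extension operator for functionals yields local complementation. -/
theorem exists_local_retraction_of_dual_extension (j : Y →L[ℝ] X) (hj : Function.Injective j)
    (E : StrongDual ℝ Y →L[ℝ] StrongDual ℝ X) (hE : ∀ f y, E f (j y) = f y)
    (F : Submodule ℝ X) [FiniteDimensional ℝ F] :
    ∃ r : F →L[ℝ] Y, ‖r‖ ≤ 2 * (‖E‖ + 1) ∧ ∀ (y : Y) (h : j y ∈ F), r ⟨j y, h⟩ = y := by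
  let G : Submodule ℝ Y := F.comap (j : Y →ₗ[ℝ] X)
  let i : G →ₗ[ℝ] F := (j : Y →ₗ[ℝ] X).restrict fun _ h => h
  have hi : LinearMap.ker i = ⊥ := LinearMap.ker_eq_bot.2 fun a b hab =>
    Subtype.ext (hj (congrArg Subtype.val hab))
  obtain ⟨p, hp⟩ := i.exists_leftInverse_of_injective hi
  have hpi : ∀ a, p (i a) = a := fun a => LinearMap.congr_fun hp a
  have : ProperSpace F := FiniteDimensional.proper_real F
  obtain ⟨t, ht, htfin, hcover⟩ :=
    (isCompact_closedBall (0 : F) 1).finite_cover_balls (e := 1 / 2) (by norm_num)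
  have := htfin.fintype
  obtain ⟨S, hS⟩ := exists_linearMap_norm_lt_of_dual_extension j E hE F (i ∘ₗ p) (G.subtype ∘ₗ p)
    (fun _ => rfl) (fun k : t => (k : F)) fun k => mem_closedBall_zero_iff.1 (ht k.2)
  let r : F →ₗ[ℝ] Y := G.subtype ∘ₗ p + S ∘ₗ (LinearMap.id - i ∘ₗ p)
  refine ⟨LinearMap.toContinuousLinearMap r,
    ContinuousLinearMap.opNorm_le_of_half_net _ (by positivity) hcover
      fun k hk => (hS ⟨k, hk⟩).le, fun y h => ?_⟩
  have hy : p ⟨j y, h⟩ = ⟨y, h⟩ := hpi ⟨y, h⟩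
  have hy' : i ⟨y, h⟩ = ⟨j y, h⟩ := rfl
  simp [r, hy, hy']

/-- An extension operator for bilinear forms induces one for functionals. -/
theorem exists_dual_extension_of_bilinear_extension (j : Y →L[ℝ] X)
    (Φ : (Y →L[ℝ] Y →L[ℝ] ℝ) →L[ℝ] (X →L[ℝ] X →L[ℝ] ℝ))
    (hΦ : ∀ (φ : Y →L[ℝ] Y →L[ℝ] ℝ) (y₁ y₂ : Y), Φ φ (j y₁) (j y₂) = φ y₁ y₂) :
    ∃ E : StrongDual ℝ Y →L[ℝ] StrongDual ℝ X, ∀ f y, E f (j y) = f y := by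
  rcases subsingleton_or_nontrivial Y with _ | _
  · exact ⟨0, fun f y => by simp [Subsingleton.elim y 0]⟩
  obtain ⟨e, he⟩ := exists_ne (0 : Y)
  obtain ⟨f₀, hf₀⟩ := SeparatingDual.exists_eq_one (R := ℝ) he
  refine ⟨(ContinuousLinearMap.compL ℝ X (X →L[ℝ] ℝ) ℝ
    (ContinuousLinearMap.apply ℝ ℝ (j e))).comp
      (Φ.comp ((ContinuousLinearMap.smulRightL ℝ Y (Y →L[ℝ] ℝ)).flip f₀)), fun f y => ?_⟩
  simp [hΦ, hf₀]

end LinearExtension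


/-- If there is a bounded linear extension operator for continuous bilinear forms
from `Y` to `X` (through the isometric embedding `j`), then `Y` is locally
complemented in `X`. -/
theorem locally_complemented_of_bilinear_extension_operator
    {Y X : Type*} [NormedAddCommGroup Y] [NormedSpace ℝ Y] [CompleteSpace Y]
    [NormedAddCommGroup X] [NormedSpace ℝ X] [CompleteSpace X]
    (j : Y →L[ℝ] X) (hj : ∀ y, ‖j y‖ = ‖y‖) (hrange : IsClosed (Set.range j))
    (Φ : (Y →L[ℝ] Y →L[ℝ] ℝ) →L[ℝ] (X →L[ℝ] X →L[ℝ] ℝ))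
    (hΦ : ∀ (φ : Y →L[ℝ] Y →L[ℝ] ℝ) (y₁ y₂ : Y), Φ φ (j y₁) (j y₂) = φ y₁ y₂) :
    ∃ lam : ℝ, 0 < lam ∧ ∀ F : Submodule ℝ X, FiniteDimensional ℝ F →
      ∃ r : F →L[ℝ] Y, ‖r‖ ≤ lam ∧ ∀ (y : Y) (h : j y ∈ F), r ⟨j y, h⟩ = y := by
  obtain ⟨E, hE⟩ := exists_dual_extension_of_bilinear_extension j Φ hΦ
  have hinj : Function.Injective j := (AddMonoidHomClass.isometry_of_norm j hj).injective
  exact ⟨2 * (‖E‖ + 1), by positivity, fun F _ =>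
    exists_local_retraction_of_dual_extension j hinj E hE F⟩
end

section
/- Let X be an infinite-dimensional Banach space in which every closed subspace is locally complemented (i.e., for every closed subspace Y there is λ_Y such that Y is locally λ_Y-complemented in X). Then X is isomorphic to a Hilbert space. -/
section

open MeasureTheory ProbabilityTheory Module
open scoped RealInnerProductSpace

section Gaussian

variable {E : Type*} [NormedAddCommGroup E] [InnerProductSpace ℝ E]

theorem norm_sq_rotation (a b : E) {c s : ℝ} (h : c ^ 2 + s ^ 2 = 1) :
    ‖c • a - s • b‖ ^ 2 + ‖s • a + c • b‖ ^ 2 = ‖a‖ ^ 2 + ‖b‖ ^ 2 := by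
  rw [norm_sub_sq_real, norm_add_sq_real]
  simp only [norm_smul, inner_smul_left, inner_smul_right, mul_pow, Real.norm_eq_abs, sq_abs,
    RCLike.conj_to_real]
  linear_combination (‖a‖ ^ 2 + ‖b‖ ^ 2) * h

variable [FiniteDimensional ℝ E] [MeasurableSpace E] [BorelSpace E]

/-- Rotations of the product `E × E` preserve the product of standard Gaussian measures. -/
theorem measurePreserving_rotation_stdGaussian {c s : ℝ} (h : c ^ 2 + s ^ 2 = 1) :
    MeasurePreserving (fun p : E × E ↦ (c • p.1 + s • p.2, -s • p.1 + c • p.2))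
      ((stdGaussian E).prod (stdGaussian E)) ((stdGaussian E).prod (stdGaussian E)) := by
  let R : E × E →L[ℝ] E × E :=
    (c • ContinuousLinearMap.fst ℝ E E + s • ContinuousLinearMap.snd ℝ E E).prod
      (-s • ContinuousLinearMap.fst ℝ E E + c • ContinuousLinearMap.snd ℝ E E)
  have hR : (fun p : E × E ↦ (c • p.1 + s • p.2, -s • p.1 + c • p.2)) = R := by
    ext p <;> simp [R]
  rw [hR]
  refine ⟨R.continuous.measurable, ?_⟩
  have : IsProbabilityMeasure (((stdGaussian E).prod (stdGaussian E)).map R) :=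
    Measure.isProbabilityMeasure_map R.continuous.aemeasurable
  apply Measure.ext_of_charFunDual
  ext L
  rw [charFunDual_map, charFunDual_prod, charFunDual_prod]
  simp_rw [charFunDual_stdGaussian]
  obtain ⟨a, ha⟩ := (InnerProductSpace.toDual ℝ E).surjective (L ∘SL ContinuousLinearMap.inl ℝ E E)
  obtain ⟨b, hb⟩ := (InnerProductSpace.toDual ℝ E).surjective (L ∘SL ContinuousLinearMap.inr ℝ E E)
  have hL (x y : E) : L (x, y) = ⟪a, x⟫ + ⟪b, y⟫ := by
    rw [← InnerProductSpace.toDual_apply_apply (𝕜 := ℝ),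
      ← InnerProductSpace.toDual_apply_apply (𝕜 := ℝ),
      ha, hb]
    simp [← map_add]
  have h1 : (L ∘SL R) ∘SL ContinuousLinearMap.inl ℝ E E
      = InnerProductSpace.toDual ℝ E (c • a - s • b) := by
    ext x
    simp [R, hL, inner_smul_right]
    ring
  have h2 : (L ∘SL R) ∘SL ContinuousLinearMap.inr ℝ E E
      = InnerProductSpace.toDual ℝ E (s • a + c • b) := by
    ext x
    simp [R, hL, inner_smul_right]
  rw [h1, h2, ← ha, ← hb]
  simp_rw [LinearIsometryEquiv.norm_map]
  rw [← Complex.exp_add, ← Complex.exp_add]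
  congr 1
  have := norm_sq_rotation a b h
  have h3 : ((‖c • a - s • b‖ ^ 2 + ‖s • a + c • b‖ ^ 2 : ℝ) : ℂ)
    = ((‖a‖ ^ 2 + ‖b‖ ^ 2 : ℝ) : ℂ) := by rw [this]
  push_cast at h3
  linear_combination (-1 / 2) * h3

/-- A linear combination, with coefficients on the unit sphere, of independent standard Gaussian
vectors is a standard Gaussian vector. -/
theorem measurePreserving_sum_smul_stdGaussian {ι : Type*} [Fintype ι] (a : EuclideanSpace ℝ ι)
    (ha : ‖a‖ = 1) :
    MeasurePreserving (fun w : ι → E ↦ ∑ j, a j • w j)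
      (Measure.pi fun _ ↦ stdGaussian E) (stdGaussian E) := by
  have hm : Measurable (fun w : ι → E ↦ ∑ j, a j • w j) := by fun_prop
  refine ⟨hm, ?_⟩
  have : IsProbabilityMeasure (((Measure.pi fun _ : ι ↦ stdGaussian E)).map
      (fun w : ι → E ↦ ∑ j, a j • w j)) :=
    Measure.isProbabilityMeasure_map hm.aemeasurable
  apply Measure.ext_of_charFun
  ext t
  rw [charFun_apply, integral_map hm.aemeasurable
    (Measurable.aestronglyMeasurable (by fun_prop))]
  simp_rw [sum_inner, Complex.ofReal_sum, Finset.sum_mul, Complex.exp_sum]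
  rw [integral_fintype_prod_eq_prod
    (f := fun j (x : E) ↦ Complex.exp (⟪a j • x, t⟫ * Complex.I))]
  have key (j : ι) : ∫ x : E, Complex.exp (⟪a j • x, t⟫ * Complex.I) ∂(stdGaussian E)
      = Complex.exp (-(‖a j • t‖ : ℂ) ^ 2 / 2) := by
    rw [← charFun_stdGaussian, charFun_apply]
    simp [inner_smul_left, inner_smul_right]
  simp_rw [key]
  rw [charFun_stdGaussian, ← Complex.exp_sum]
  congr 1
  have h1 : ∑ j, a j ^ 2 = 1 := by
    rw [← EuclideanSpace.real_norm_sq_eq, ha, one_pow]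
  have h2 : ((∑ j, a j ^ 2 : ℝ) : ℂ) = 1 := by rw [h1]; simp
  push_cast at h2
  have h3 (j : ι) : -(‖a j • t‖ : ℂ) ^ 2 / 2 = (a j : ℂ) ^ 2 * (-(‖t‖ : ℂ) ^ 2 / 2) := by
    have : ‖a j • t‖ ^ 2 = a j ^ 2 * ‖t‖ ^ 2 := by
      rw [norm_smul, mul_pow, Real.norm_eq_abs, sq_abs]
    have h' : ((‖a j • t‖ ^ 2 : ℝ) : ℂ) = ((a j ^ 2 * ‖t‖ ^ 2 : ℝ) : ℂ) := by rw [this]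
    push_cast at h'
    rw [h']; ring
  simp_rw [h3, ← Finset.sum_mul, h2, one_mul]

theorem lintegral_dual_sq_stdGaussian (L : StrongDual ℝ E) :
    ∫⁻ x, ENNReal.ofReal (L x ^ 2) ∂(stdGaussian E) = ENNReal.ofReal (‖L‖ ^ 2) := by
  rw [← variance_dual_stdGaussian L,
    ofReal_variance (IsGaussian.memLp_dual _ L 2 (by simp)),
    evariance_eq_lintegral_ofReal]
  simp

theorem exists_lintegral_norm_sq_stdGaussian_le :
    ∃ m : ℝ, 0 ≤ m ∧ ∫⁻ x : E, ENNReal.ofReal (‖x‖ ^ 2) ∂(stdGaussian E) ≤ ENNReal.ofReal m := by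
  have h : MemLp (id : E → E) 2 (stdGaussian E) := IsGaussian.memLp_two_id
  have h2 := h.integrable_norm_pow (by simp)
  refine ⟨∫ x : E, ‖x‖ ^ 2 ∂(stdGaussian E), by positivity, ?_⟩
  rw [ofReal_integral_eq_lintegral_ofReal (by simpa using h2) (by filter_upwards; intros; simp)]

variable {V : Type*} [NormedAddCommGroup V] [NormedSpace ℝ V]

/-- The positive part of the increment of `x ↦ ‖u x‖` under a small rotation, estimated through a
norming functional at the base point. -/
theorem lintegral_posPart_increment_le (u : E →L[ℝ] V) (hu : ∀ x, ‖u x‖ ≤ ‖x‖) {c s m : ℝ}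
    (hc : c ≤ 1)
    (hm : ∫⁻ x : E, ENNReal.ofReal (‖x‖ ^ 2) ∂(stdGaussian E) ≤ ENNReal.ofReal m) (hm0 : 0 ≤ m) :
    ∫⁻ p : E × E, ENNReal.ofReal ((max (‖u p.1‖ - ‖u (c • p.1 + s • p.2)‖) 0) ^ 2)
      ∂((stdGaussian E).prod (stdGaussian E)) ≤
      ENNReal.ofReal (2 * (1 - c) ^ 2 * m + 2 * s ^ 2) := by
  have hmeas : Measurable fun p : E × E ↦
      ENNReal.ofReal ((max (‖u p.1‖ - ‖u (c • p.1 + s • p.2)‖) 0) ^ 2) := by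
    fun_prop
  rw [lintegral_prod _ hmeas.aemeasurable]
  have key (x : E) : ∫⁻ y : E, ENNReal.ofReal ((max (‖u x‖ - ‖u (c • x + s • y)‖) 0) ^ 2)
      ∂(stdGaussian E) ≤ ENNReal.ofReal (2 * (1 - c) ^ 2) * ENNReal.ofReal (‖x‖ ^ 2)
        + ENNReal.ofReal (2 * s ^ 2) := by
    obtain ⟨g, hg1, hg2⟩ := exists_dual_vector'' ℝ (u x)
    have hg2' : g (u x) = ‖u x‖ := by simpa using hg2
    have hgle (v : V) : g v ≤ ‖v‖ :=
      (le_abs_self _).trans ((g.le_opNorm v).trans (by nlinarith [norm_nonneg v]))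
    have hgu : ‖g ∘SL u‖ ≤ 1 := by
      refine ContinuousLinearMap.opNorm_le_bound _ zero_le_one fun y ↦ ?_
      calc ‖g (u y)‖ ≤ ‖g‖ * ‖u y‖ := g.le_opNorm _
        _ ≤ 1 * ‖y‖ := by gcongr; exact hu y
    have hpt (y : E) : (max (‖u x‖ - ‖u (c • x + s • y)‖) 0) ^ 2
        ≤ 2 * (1 - c) ^ 2 * ‖x‖ ^ 2 + 2 * s ^ 2 * (g ∘SL u) y ^ 2 := by
      have h1 : ‖u x‖ - ‖u (c • x + s • y)‖ ≤ (1 - c) * ‖x‖ - s * (g ∘SL u) y := by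
        have := hgle (u (c • x + s • y))
        simp only [map_add, map_smul, smul_eq_mul, hg2'] at this ⊢
        simp only [ContinuousLinearMap.comp_apply]
        have := mul_le_mul_of_nonneg_left (hu x) (sub_nonneg.2 hc)
        linarith
      have h2 : (max (‖u x‖ - ‖u (c • x + s • y)‖) 0) ^ 2
          ≤ ((1 - c) * ‖x‖ - s * (g ∘SL u) y) ^ 2 := by
        rcases le_total (‖u x‖ - ‖u (c • x + s • y)‖) 0 with h | h
        · rw [max_eq_right h, zero_pow two_ne_zero]; exact sq_nonneg _
        · rw [max_eq_left h]
          exact pow_le_pow_left₀ h h1 2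
      nlinarith [sq_nonneg ((1 - c) * ‖x‖ + s * (g ∘SL u) y)]
    calc ∫⁻ y : E, ENNReal.ofReal ((max (‖u x‖ - ‖u (c • x + s • y)‖) 0) ^ 2) ∂(stdGaussian E)
        ≤ ∫⁻ y : E, (ENNReal.ofReal (2 * (1 - c) ^ 2) * ENNReal.ofReal (‖x‖ ^ 2)
          + ENNReal.ofReal (2 * s ^ 2) * ENNReal.ofReal ((g ∘SL u) y ^ 2)) ∂(stdGaussian E) := by
          refine lintegral_mono fun y ↦ ?_
          rw [← ENNReal.ofReal_mul (by positivity), ← ENNReal.ofReal_mul (by positivity),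
            ← ENNReal.ofReal_add (by positivity) (by positivity)]
          exact ENNReal.ofReal_le_ofReal (hpt y)
      _ = ENNReal.ofReal (2 * (1 - c) ^ 2) * ENNReal.ofReal (‖x‖ ^ 2)
          + ENNReal.ofReal (2 * s ^ 2) * ENNReal.ofReal (‖g ∘SL u‖ ^ 2) := by
          rw [lintegral_add_left measurable_const, lintegral_const,
            lintegral_const_mul' _ _ (by finiteness), lintegral_dual_sq_stdGaussian]
          simp
      _ ≤ _ := by
          gcongr
          rw [← ENNReal.ofReal_mul (by positivity)]
          apply ENNReal.ofReal_le_ofReal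
          have : ‖g ∘SL u‖ ^ 2 ≤ 1 := pow_le_one₀ (norm_nonneg _) hgu
          nlinarith [sq_nonneg s]
  calc _ ≤ ∫⁻ x : E, (ENNReal.ofReal (2 * (1 - c) ^ 2) * ENNReal.ofReal (‖x‖ ^ 2)
        + ENNReal.ofReal (2 * s ^ 2)) ∂(stdGaussian E) := lintegral_mono key
    _ = ENNReal.ofReal (2 * (1 - c) ^ 2) * ∫⁻ x : E, ENNReal.ofReal (‖x‖ ^ 2) ∂(stdGaussian E)
        + ENNReal.ofReal (2 * s ^ 2) := by
        rw [lintegral_add_right _ measurable_const, lintegral_const_mul' _ _ (by finiteness)]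
        simp
    _ ≤ ENNReal.ofReal (2 * (1 - c) ^ 2) * ENNReal.ofReal m + ENNReal.ofReal (2 * s ^ 2) := by
        gcongr
    _ = _ := by
        rw [← ENNReal.ofReal_mul (by positivity), ← ENNReal.ofReal_add (by positivity)
          (by positivity)]

theorem lintegral_increment_le (u : E →L[ℝ] V) (hu : ∀ x, ‖u x‖ ≤ ‖x‖) {c s m : ℝ}
    (hc : c ≤ 1) (hcs : c ^ 2 + s ^ 2 = 1)
    (hm : ∫⁻ x : E, ENNReal.ofReal (‖x‖ ^ 2) ∂(stdGaussian E) ≤ ENNReal.ofReal m) (hm0 : 0 ≤ m) :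
    ∫⁻ p : E × E, ENNReal.ofReal ((‖u (c • p.1 + s • p.2)‖ - ‖u p.1‖) ^ 2)
      ∂((stdGaussian E).prod (stdGaussian E)) ≤
      ENNReal.ofReal (4 * (1 - c) ^ 2 * m + 4 * s ^ 2) := by
  have h1 := lintegral_posPart_increment_le u hu (s := s) hc hm hm0
  have h2 := lintegral_posPart_increment_le u hu (s := -s) hc hm hm0
  have hmeas : Measurable fun p : E × E ↦
      ENNReal.ofReal ((max (‖u p.1‖ - ‖u (c • p.1 + (-s) • p.2)‖) 0) ^ 2) := by
    fun_prop
  rw [← (measurePreserving_rotation_stdGaussian hcs).lintegral_comp hmeas] at h2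
  have hback (p : E × E) : c • (c • p.1 + s • p.2) + (-s) • (-s • p.1 + c • p.2) = p.1 := by
    have : c • (c • p.1 + s • p.2) + (-s) • (-s • p.1 + c • p.2) = (c ^ 2 + s ^ 2) • p.1 := by
      module
    rw [this, hcs, one_smul]
  simp only [hback] at h2
  have hmeas1 : Measurable fun p : E × E ↦
      ENNReal.ofReal ((max (‖u p.1‖ - ‖u (c • p.1 + s • p.2)‖) 0) ^ 2) := by
    fun_prop
  calc _ = ∫⁻ p : E × E, (ENNReal.ofReal ((max (‖u p.1‖ - ‖u (c • p.1 + s • p.2)‖) 0) ^ 2)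
        + ENNReal.ofReal ((max (‖u (c • p.1 + s • p.2)‖ - ‖u p.1‖) 0) ^ 2))
        ∂((stdGaussian E).prod (stdGaussian E)) := by
        refine lintegral_congr fun p ↦ ?_
        rw [← ENNReal.ofReal_add (by positivity) (by positivity)]
        congr 1
        rcases le_total (‖u p.1‖) (‖u (c • p.1 + s • p.2)‖) with h | h
        · rw [max_eq_right (by linarith), max_eq_left (by linarith)]; ring
        · rw [max_eq_left (by linarith), max_eq_right (by linarith)]; ring
    _ ≤ ENNReal.ofReal (2 * (1 - c) ^ 2 * m + 2 * s ^ 2)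
        + ENNReal.ofReal (2 * (1 - c) ^ 2 * m + 2 * (-s) ^ 2) := by
        rw [lintegral_add_left hmeas1]
        exact add_le_add h1 h2
    _ = _ := by
        rw [← ENNReal.ofReal_add (by positivity) (by positivity)]
        congr 1; ring

/-- Gaussian concentration in mean square for the norm of a contraction, with a constant that does
not depend on the dimension. -/
theorem lintegral_norm_sub_norm_sq_le (u : E →L[ℝ] V) (hu : ∀ x, ‖u x‖ ≤ ‖x‖) :
    ∫⁻ p : E × E, ENNReal.ofReal ((‖u p.2‖ - ‖u p.1‖) ^ 2)
      ∂((stdGaussian E).prod (stdGaussian E)) ≤ ENNReal.ofReal 16 := by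
  obtain ⟨m, hm0, hm⟩ := exists_lintegral_norm_sq_stdGaussian_le (E := E)
  obtain ⟨N, hN⟩ := exists_nat_ge (2 * m + 1)
  have hN1 : (1 : ℝ) ≤ N := by linarith
  set δ : ℝ := Real.pi / 2 / N with hδ
  have hNδ : N * δ = Real.pi / 2 := by rw [hδ]; field_simp
  have hδ0 : 0 ≤ δ := by positivity
  let Θ : ℕ → E × E → E := fun k p ↦ Real.cos (k * δ) • p.1 + Real.sin (k * δ) • p.2
  let D : ℝ := 4 * (1 - Real.cos δ) ^ 2 * m + 4 * Real.sin δ ^ 2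
  have hstep (k : ℕ) : ∫⁻ p : E × E, ENNReal.ofReal ((‖u (Θ (k + 1) p)‖ - ‖u (Θ k p)‖) ^ 2)
      ∂((stdGaussian E).prod (stdGaussian E)) ≤ ENNReal.ofReal D := by
    have h1 := lintegral_increment_le u hu (Real.cos_le_one δ) (Real.cos_sq_add_sin_sq δ) hm hm0
    have hmeas : Measurable fun p : E × E ↦
        ENNReal.ofReal ((‖u (Real.cos δ • p.1 + Real.sin δ • p.2)‖ - ‖u p.1‖) ^ 2) := by
      fun_prop
    rw [← (measurePreserving_rotation_stdGaussian
      (Real.cos_sq_add_sin_sq (k * δ))).lintegral_comp hmeas] at h1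
    convert h1 using 6 with p
    · congr 2
      simp only [Θ]
      push_cast
      rw [add_mul, one_mul, Real.cos_add, Real.sin_add]
      module
  have hpt (p : E × E) : (‖u p.2‖ - ‖u p.1‖) ^ 2
      ≤ N * ∑ k ∈ Finset.range N, (‖u (Θ (k + 1) p)‖ - ‖u (Θ k p)‖) ^ 2 := by
    have h1 := Finset.sum_range_sub (fun k ↦ ‖u (Θ k p)‖) N
    have h0 : Θ 0 p = p.1 := by simp [Θ]
    have hlast : Θ N p = p.2 := by simp [Θ, hNδ]
    rw [h0, hlast] at h1
    rw [← h1]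
    simpa using sq_sum_le_card_mul_sum_sq (s := Finset.range N)
      (f := fun k ↦ ‖u (Θ (k + 1) p)‖ - ‖u (Θ k p)‖)
  have hD : N * (N * D) ≤ 16 := by
    have h1 : 1 - Real.cos δ ≤ δ ^ 2 / 2 := by linarith [Real.one_sub_sq_div_two_le_cos (x := δ)]
    have h2 : 0 ≤ 1 - Real.cos δ := by linarith [Real.cos_le_one δ]
    have h3 : (1 - Real.cos δ) ^ 2 ≤ (δ ^ 2 / 2) ^ 2 := pow_le_pow_left₀ h2 h1 2
    have h4 : Real.sin δ ^ 2 ≤ δ ^ 2 := Real.sin_sq_le_sq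
    have h5 : D ≤ δ ^ 4 * m + 4 * δ ^ 2 := by
      simp only [D]
      nlinarith
    have hpi : Real.pi / 2 ≤ 1.58 := by linarith [Real.pi_lt_d2]
    have hpi0 : 0 ≤ Real.pi / 2 := by positivity
    have hp2 : (Real.pi / 2) ^ 2 ≤ 2.5 := by nlinarith
    have h6 : N * (N * D) ≤ (Real.pi / 2) ^ 2 * (δ ^ 2 * m + 4) := by
      calc N * (N * D) ≤ N * (N * (δ ^ 4 * m + 4 * δ ^ 2)) := by gcongr
        _ = (N * δ) ^ 2 * (δ ^ 2 * m + 4) := by ring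
        _ = _ := by rw [hNδ]
    have h7 : δ ^ 2 * m ≤ 2 := by
      have h8 : (N * δ) ^ 2 ≤ 2.5 := by rw [hNδ]; exact hp2
      have h9 : m ≤ N ^ 2 / 2 := by nlinarith
      have : δ ^ 2 * m ≤ δ ^ 2 * (N ^ 2 / 2) := by gcongr
      nlinarith
    nlinarith
  calc _ ≤ ∫⁻ p : E × E, ENNReal.ofReal N * ∑ k ∈ Finset.range N,
        ENNReal.ofReal ((‖u (Θ (k + 1) p)‖ - ‖u (Θ k p)‖) ^ 2)
        ∂((stdGaussian E).prod (stdGaussian E)) := by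
        refine lintegral_mono fun p ↦ ?_
        rw [← ENNReal.ofReal_sum_of_nonneg (fun _ _ ↦ sq_nonneg _),
          ← ENNReal.ofReal_mul (by positivity)]
        exact ENNReal.ofReal_le_ofReal (hpt p)
    _ = ENNReal.ofReal N * ∑ k ∈ Finset.range N,
        ∫⁻ p : E × E, ENNReal.ofReal ((‖u (Θ (k + 1) p)‖ - ‖u (Θ k p)‖) ^ 2)
        ∂((stdGaussian E).prod (stdGaussian E)) := by
        rw [lintegral_const_mul' _ _ (by finiteness), lintegral_finsetSum]
        intro k _
        simp only [Θ]
        fun_prop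
    _ ≤ ENNReal.ofReal N * ∑ k ∈ Finset.range N, ENNReal.ofReal D := by
        gcongr with k _
        exact hstep k
    _ ≤ ENNReal.ofReal 16 := by
        rw [Finset.sum_const, Finset.card_range, nsmul_eq_mul, ← ENNReal.ofReal_natCast,
          ← ENNReal.ofReal_mul (by positivity), ← ENNReal.ofReal_mul (by positivity)]
        exact ENNReal.ofReal_le_ofReal hD

end Gaussian
section DvoretzkyRogers

variable {V : Type*} [NormedAddCommGroup V] [NormedSpace ℝ V]

theorem exists_injective_euclideanSpace_of_infinite (hV : ¬ FiniteDimensional ℝ V) (n : ℕ) :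
    ∃ T : EuclideanSpace ℝ (Fin n) →L[ℝ] V, Function.Injective T := by
  have hr : (n : Cardinal) ≤ Module.rank ℝ V := by
    have : Cardinal.aleph0 ≤ Module.rank ℝ V := by
      by_contra h
      exact hV (Module.rank_lt_aleph0_iff.1 (not_le.1 h))
    exact (Cardinal.natCast_lt_aleph0).le.trans this
  obtain ⟨s, hs, hli⟩ := exists_finset_linearIndependent_of_le_rank hr
  let e : Fin n ≃ s := (Fintype.equivFinOfCardEq (by simpa using hs)).symm
  have hli' : LinearIndependent ℝ (fun i : Fin n ↦ ((e i : s) : V)) :=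
    hli.comp e e.injective
  let T : EuclideanSpace ℝ (Fin n) →ₗ[ℝ] V :=
    (Fintype.linearCombination ℝ (fun i : Fin n ↦ ((e i : s) : V))) ∘ₗ
      (WithLp.linearEquiv 2 ℝ (Fin n → ℝ)).toLinearMap
  refine ⟨T.toContinuousLinearMap, ?_⟩
  have : Function.Injective T := by
    simp only [T, LinearMap.coe_comp, LinearEquiv.coe_coe]
    exact (linearIndependent_iff_injective_fintypeLinearCombination.1 hli').comp (LinearEquiv.injective _)
  exact this

/-- Among the endomorphisms `A` of a Euclidean space such that `T ∘ A` is a contraction, one of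
them maximizes the determinant. -/
theorem exists_forall_abs_det_le {H : Type*} [NormedAddCommGroup H] [InnerProductSpace ℝ H]
    [FiniteDimensional ℝ H] (T : H →L[ℝ] V) (hT : Function.Injective T) :
    ∃ A : H →L[ℝ] H, (∀ x, ‖T (A x)‖ ≤ ‖x‖) ∧ A.det ≠ 0 ∧
      ∀ B : H →L[ℝ] H, (∀ x, ‖T (B x)‖ ≤ ‖x‖) → |B.det| ≤ |A.det| := by
  let K : Set (H →L[ℝ] H) := {A | ∀ x, ‖T (A x)‖ ≤ ‖x‖}
  have hclosed : IsClosed K := by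
    simp only [K, Set.ofPred_forall]
    refine isClosed_iInter fun x ↦ isClosed_le ?_ continuous_const
    fun_prop
  obtain ⟨c, hc0, hc⟩ := (T : H →ₗ[ℝ] V).exists_antilipschitzWith (LinearMap.ker_eq_bot.2 hT)
  have hbdd : Bornology.IsBounded K := by
    refine (Metric.isBounded_closedBall (x := (0 : H →L[ℝ] H)) (r := c)).subset fun A hA ↦ ?_
    rw [mem_closedBall_zero_iff]
    refine ContinuousLinearMap.opNorm_le_bound _ c.2 fun x ↦ ?_
    have h1 := hc.le_mul_dist (A x) 0
    simp only [dist_zero_right, map_zero] at h1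
    exact h1.trans (mul_le_mul_of_nonneg_left (hA x) c.2)
  have : ProperSpace (H →L[ℝ] H) := FiniteDimensional.proper ℝ _
  have hcomp : IsCompact K := Metric.isCompact_of_isClosed_isBounded hclosed hbdd
  obtain ⟨A, hA, hmax⟩ := hcomp.exists_isMaxOn ⟨0, fun x ↦ by simp⟩
    (f := fun A ↦ |A.det|) ContinuousLinearMap.continuous_det.abs.continuousOn
  refine ⟨A, hA, fun h0 ↦ ?_, fun B hB ↦ hmax hB⟩
  have hpos : 0 < ‖T‖ + 1 := by positivity
  have hI : ((‖T‖ + 1)⁻¹ • ContinuousLinearMap.id ℝ H) ∈ K := fun x ↦ by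
    simp only [smul_apply, ContinuousLinearMap.id_apply, map_smul, norm_smul,
      norm_inv, Real.norm_eq_abs, abs_of_pos hpos]
    rw [inv_mul_le_iff₀ hpos]
    exact (T.le_opNorm x).trans (by gcongr; linarith)
  have h1 := hmax hI
  simp only [Set.mem_ofPred_eq, h0, abs_zero, abs_nonpos_iff] at h1
  rw [ContinuousLinearMap.det, ContinuousLinearMap.toLinearMap_smul, LinearMap.det_smul] at h1
  have h2 : ((‖T‖ + 1)⁻¹) ^ Module.finrank ℝ H ≠ 0 := by positivity
  simp [hpos.ne'] at h1

/-- If `T ∘ A` is a contraction with `|det A|` maximal, then it is not uniformly small on the span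
of more than half of the vectors of an orthonormal basis. -/
theorem exists_le_norm_of_det_maximal {k j : ℕ} (hj : j < k)
    (T : EuclideanSpace ℝ (Fin (2 * k)) →L[ℝ] V)
    (A : EuclideanSpace ℝ (Fin (2 * k)) →L[ℝ] EuclideanSpace ℝ (Fin (2 * k)))
    (hA : ∀ x, ‖T (A x)‖ ≤ ‖x‖) (hdet : A.det ≠ 0)
    (hmax : ∀ B : EuclideanSpace ℝ (Fin (2 * k)) →L[ℝ] EuclideanSpace ℝ (Fin (2 * k)),
      (∀ x, ‖T (B x)‖ ≤ ‖x‖) → |B.det| ≤ |A.det|)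
    (b : OrthonormalBasis (Fin (2 * k)) ℝ (EuclideanSpace ℝ (Fin (2 * k)))) :
    ∃ v, ‖v‖ = 1 ∧ (∀ i : Fin (2 * k), (i : ℕ) < j → ⟪b i, v⟫ = 0) ∧ 2 / 5 ≤ ‖T (A v)‖ := by
  by_contra! hcon
  have hsmall (v : EuclideanSpace ℝ (Fin (2 * k)))
      (hv : ∀ i : Fin (2 * k), (i : ℕ) < j → ⟪b i, v⟫ = 0) : ‖T (A v)‖ ≤ 2 / 5 * ‖v‖ := by
    rcases eq_or_ne v 0 with rfl | h0
    · simp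
    have hn : 0 < ‖v‖ := norm_pos_iff.2 h0
    have h1 := hcon (‖v‖⁻¹ • v) (by simp [norm_smul, hn.ne'])
      (fun i hi ↦ by rw [inner_smul_right, hv i hi, mul_zero])
    simp only [map_smul, norm_smul, norm_inv, norm_norm] at h1
    rw [inv_mul_lt_iff₀ hn] at h1
    linarith
  let q : Fin (2 * k) → ℝ := fun i ↦ if (i : ℕ) < j then 0 else 1
  let Q : EuclideanSpace ℝ (Fin (2 * k)) →L[ℝ] EuclideanSpace ℝ (Fin (2 * k)) :=
    ∑ i, (q i • innerSL ℝ (b i)).smulRight (b i)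
  have hQ (x) : Q x = ∑ i, (q i * ⟪b i, x⟫) • b i := by
    simp [Q]
  have hQi (x) (i) : ⟪b i, Q x⟫ = q i * ⟪b i, x⟫ := by
    rw [hQ, b.orthonormal.inner_right_fintype]
  have hQn (x) : ‖Q x‖ ≤ ‖x‖ := by
    rw [← sq_le_sq₀ (norm_nonneg _) (norm_nonneg _), ← b.sum_sq_inner_right,
      ← b.sum_sq_inner_right x]
    refine Finset.sum_le_sum fun i _ ↦ ?_
    rw [hQi]
    simp only [q]
    split_ifs <;> simp [sq_nonneg]
  let D := ContinuousLinearMap.id ℝ (EuclideanSpace ℝ (Fin (2 * k))) + Q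
  have hDdet : D.det = ∏ i, (1 + q i) := by
    rw [ContinuousLinearMap.det, ← LinearMap.det_toMatrix b.toBasis]
    have : LinearMap.toMatrix b.toBasis b.toBasis (D : _ →ₗ[ℝ] _)
        = Matrix.diagonal (fun i ↦ 1 + q i) := by
      ext i l
      rw [LinearMap.toMatrix_apply]
      simp only [OrthonormalBasis.coe_toBasis, OrthonormalBasis.coe_toBasis_repr_apply,
        OrthonormalBasis.repr_apply_apply, ContinuousLinearMap.coe_coe, D,
        add_apply, ContinuousLinearMap.id_apply, inner_add_right, hQi,
        Matrix.diagonal_apply, orthonormal_iff_ite.1 b.orthonormal]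
      split_ifs <;> simp
    rw [this, Matrix.det_diagonal]
  have hprod : (2 : ℝ) ^ k ≤ ∏ i, (1 + q i) := by
    rw [Fin.prod_univ_eq_prod_range (fun i ↦ 1 + (if i < j then (0 : ℝ) else 1)) (2 * k),
      two_mul, Finset.prod_range_add]
    have h1 : ∏ x ∈ Finset.range k, (1 + if k + x < j then (0 : ℝ) else 1) = 2 ^ k := by
      rw [Finset.prod_congr rfl (g := fun _ ↦ (2 : ℝ))]
      · simp
      · intro x _
        rw [if_neg (by omega)]; norm_num
    rw [h1]
    refine le_mul_of_one_le_left (by positivity) (Finset.one_le_prod fun x ↦ ?_)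
    split_ifs <;> norm_num
  have h1 := hmax ((5 / 7 : ℝ) • (A ∘SL D)) fun x ↦ by
    have hx : ‖T (A (D x))‖ ≤ 7 / 5 * ‖x‖ := by
      have h2 := hsmall (Q x) fun i hi ↦ by rw [hQi]; simp [q, hi]
      calc ‖T (A (D x))‖ = ‖T (A x) + T (A (Q x))‖ := by simp [D]
        _ ≤ ‖T (A x)‖ + ‖T (A (Q x))‖ := norm_add_le _ _
        _ ≤ ‖x‖ + 2 / 5 * ‖x‖ := by
          have := hQn x
          have := hA x
          linarith
        _ = _ := by ring
    simp only [smul_apply, ContinuousLinearMap.comp_apply, map_smul, norm_smul]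
    norm_num
    linarith
  have h2 : ((5 / 7 : ℝ) • (A ∘SL D)).det = (5 / 7) ^ (2 * k) * (A.det * D.det) := by
    simp only [ContinuousLinearMap.det, ContinuousLinearMap.toLinearMap_smul, LinearMap.det_smul,
      finrank_euclideanSpace_fin]
    rw [ContinuousLinearMap.toLinearMap_comp, LinearMap.det_comp]
  rw [h2, hDdet, abs_mul, abs_mul, abs_of_pos (by positivity : (0 : ℝ) < (5 / 7) ^ (2 * k)),
    abs_of_nonneg ((by positivity : (0 : ℝ) ≤ 2 ^ k).trans hprod)] at h1
  have h3 : 1 < (5 / 7 : ℝ) ^ (2 * k) * 2 ^ k := by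
    rw [pow_mul, ← mul_pow]
    exact one_lt_pow₀ (by norm_num) (by omega)
  have h4 : 0 < |A.det| := abs_pos.2 hdet
  have h5 : (5 / 7 : ℝ) ^ (2 * k) * (|A.det| * 2 ^ k)
      ≤ (5 / 7) ^ (2 * k) * (|A.det| * ∏ i, (1 + q i)) := by gcongr
  nlinarith

/-- The Dvoretzky–Rogers lemma. -/
theorem exists_contraction_two_fifths_le (hV : ¬ FiniteDimensional ℝ V) (k : ℕ) :
    ∃ u : EuclideanSpace ℝ (Fin k) →L[ℝ] V, (∀ x, ‖u x‖ ≤ ‖x‖) ∧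
      ∀ i, 2 / 5 ≤ ‖u (EuclideanSpace.single i 1)‖ := by
  obtain ⟨T, hT⟩ := exists_injective_euclideanSpace_of_infinite hV (2 * k)
  obtain ⟨A, hA, hdet, hmax⟩ := exists_forall_abs_det_le T hT
  have key (j : ℕ) (hj : j ≤ k) :
      ∃ b : OrthonormalBasis (Fin (2 * k)) ℝ (EuclideanSpace ℝ (Fin (2 * k))),
        ∀ i : Fin (2 * k), (i : ℕ) < j → 2 / 5 ≤ ‖T (A (b i))‖ := by
    induction j with
    | zero => exact ⟨EuclideanSpace.basisFun _ _, by simp⟩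
    | succ j ih =>
      obtain ⟨b, hb⟩ := ih (by omega)
      obtain ⟨v, hv1, hvo, hvT⟩ := exists_le_norm_of_det_maximal (Nat.lt_of_succ_le hj) T A hA hdet hmax b
      let j' : Fin (2 * k) := ⟨j, by omega⟩
      let w : Fin (2 * k) → EuclideanSpace ℝ (Fin (2 * k)) := Function.update b j' v
      have hw1 (i : Fin (2 * k)) (hi : (i : ℕ) < j) : w i = b i := by
        simp only [w]
        rw [Function.update_of_ne]
        rintro rfl
        simp [j'] at hi
      have hw2 : w j' = v := by simp [w]
      have hon : Orthonormal ℝ (({i : Fin (2 * k) | (i : ℕ) < j + 1}).domRestrict w) := by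
        have hcases (i : Fin (2 * k)) (hi : (i : ℕ) < j + 1) : (i : ℕ) < j ∨ i = j' := by
          rcases Nat.lt_succ_iff_lt_or_eq.1 hi with h | h
          · exact .inl h
          · exact .inr (Fin.ext h)
        refine ⟨fun ⟨i, hi⟩ ↦ ?_, fun ⟨i, hi⟩ ⟨l, hl⟩ hil ↦ ?_⟩
        · simp only [Set.domRestrict_apply]
          rcases hcases i hi with h | rfl
          · rw [hw1 i h]; exact b.orthonormal.1 i
          · rw [hw2, hv1]
        · simp only [Set.domRestrict_apply]
          have hne : i ≠ l := fun h ↦ hil (Subtype.ext h)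
          rcases hcases i hi with h | rfl <;> rcases hcases l hl with h' | rfl
          · rw [hw1 i h, hw1 l h']; exact b.orthonormal.2 hne
          · rw [hw1 i h, hw2]; exact hvo i h
          · rw [hw1 l h', hw2, real_inner_comm]; exact hvo l h'
          · exact absurd rfl hne
      obtain ⟨b', hb'⟩ := hon.exists_orthonormalBasis_extension_of_card_eq (by simp)
      refine ⟨b', fun i hi ↦ ?_⟩
      rw [hb' i hi]
      rcases Nat.lt_succ_iff_lt_or_eq.1 hi with h | h
      · rw [hw1 i h]; exact hb i h
      · rw [show i = j' from Fin.ext h, hw2]; exact hvT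
  obtain ⟨b, hb⟩ := key k le_rfl
  let e : Fin k → Fin (2 * k) := Fin.castLE (by omega)
  have hon : Orthonormal ℝ (b ∘ e) := b.orthonormal.comp e (Fin.castLE_injective _)
  let S : EuclideanSpace ℝ (Fin k) →L[ℝ] EuclideanSpace ℝ (Fin (2 * k)) :=
    ∑ i, (EuclideanSpace.proj i : EuclideanSpace ℝ (Fin k) →L[ℝ] ℝ).smulRight ((b ∘ e) i)
  have hS (x) : S x = ∑ i, x i • (b ∘ e) i := by
    simp [S]
  have hSn (x) : ‖S x‖ = ‖x‖ := by
    rw [← sq_eq_sq₀ (norm_nonneg _) (norm_nonneg _), ← real_inner_self_eq_norm_sq, hS,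
      hon.inner_sum, EuclideanSpace.real_norm_sq_eq]
    simp [sq]
  refine ⟨T ∘SL A ∘SL S, fun x ↦ (hA _).trans (hSn x).le, fun i ↦ ?_⟩
  have : S (EuclideanSpace.single i 1) = b (e i) := by
    rw [hS, Finset.sum_eq_single i] <;> simp +contextual
  simp only [ContinuousLinearMap.comp_apply, this]
  exact hb (e i) (by simp [e])

end DvoretzkyRogers

section Concentration

variable {V : Type*} [NormedAddCommGroup V] [NormedSpace ℝ V]

theorem exists_stdGaussian_forall_abs_le_le_half (t : ℝ) :
    ∃ k : ℕ, stdGaussian (EuclideanSpace ℝ (Fin k)) {x | ∀ i, |x i| ≤ t} ≤ 2⁻¹ := by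
  set p := gaussianReal 0 1 (Set.Icc (-t) t) with hp
  have hp1 : p < 1 := by
    refine lt_of_le_of_ne prob_le_one fun h ↦ ?_
    have h0 : gaussianReal 0 1 (Set.Icc (-t) t)ᶜ = 0 :=
      (prob_compl_eq_zero_iff measurableSet_Icc).2 h
    have h1 : volume (Set.Icc (-t) t)ᶜ = 0 :=
      gaussianReal_absolutelyContinuous' 0 one_ne_zero h0
    have h2 : volume (Set.Ioi t) ≤ volume (Set.Icc (-t) t)ᶜ :=
      measure_mono fun x hx hx' ↦ absurd hx'.2 (not_le.2 hx)
    rw [h1, Real.volume_Ioi] at h2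
    simp at h2
  obtain ⟨k, hk⟩ := ((ENNReal.tendsto_pow_atTop_nhds_zero_of_lt_one hp1).eventually_le_const
    (u := 2⁻¹) (by simp)).exists
  refine ⟨k, ?_⟩
  have hmeas : MeasurableSet {x : EuclideanSpace ℝ (Fin k) | ∀ i, |x i| ≤ t} := by
    rw [Set.ofPred_forall]
    exact MeasurableSet.iInter fun i ↦ measurableSet_le (by fun_prop) (by fun_prop)
  rw [← map_pi_eq_stdGaussian, Measure.map_apply (by fun_prop) hmeas]
  have : (WithLp.toLp 2 : (Fin k → ℝ) → EuclideanSpace ℝ (Fin k)) ⁻¹' {x | ∀ i, |x i| ≤ t}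
      = Set.univ.pi fun _ ↦ Set.Icc (-t) t := by
    ext x
    simp [abs_le, Pi.le_def, forall_and]
  rw [this, Measure.pi_pi]
  simpa using hk

/-- If `u` is bounded below on the standard basis then, in large dimension, `‖u x‖` is large with
Gaussian probability at least `1 / 4`. -/
theorem quarter_le_stdGaussian_le_norm {k : ℕ} (u : EuclideanSpace ℝ (Fin k) →L[ℝ] V) {c t : ℝ}
    (hc : 0 ≤ c) (hu : ∀ i, c ≤ ‖u (EuclideanSpace.single i 1)‖)
    (ht : stdGaussian (EuclideanSpace ℝ (Fin k)) {x | ∀ i, |x i| ≤ t} ≤ 2⁻¹) :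
    4⁻¹ ≤ stdGaussian (EuclideanSpace ℝ (Fin k)) {x | c * t ≤ ‖u x‖} := by
  set μ := stdGaussian (EuclideanSpace ℝ (Fin k))
  set B : Set (EuclideanSpace ℝ (Fin k)) := {x | c * t ≤ ‖u x‖} with hB
  let A (i : Fin k) : Set (EuclideanSpace ℝ (Fin k)) := {x | t < |x i| ∧ ∀ j < i, |x j| ≤ t}
  have hBm : MeasurableSet B := measurableSet_le measurable_const u.continuous.norm.measurable
  have hAm (i : Fin k) : MeasurableSet (A i) := by
    have h1 : MeasurableSet {x : EuclideanSpace ℝ (Fin k) | t < |x i|} :=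
      measurableSet_lt (by fun_prop) (by fun_prop)
    have h2 : MeasurableSet {x : EuclideanSpace ℝ (Fin k) | ∀ j < i, |x j| ≤ t} := by
      simp_rw [Set.ofPred_forall]
      exact MeasurableSet.iInter fun j ↦ MeasurableSet.iInter fun _ ↦
        measurableSet_le (by fun_prop) (by fun_prop)
    exact h1.inter h2
  have hdisj : Pairwise (Function.onFun Disjoint A) := by
    intro i j hij
    rw [Function.onFun, Set.disjoint_left]
    rintro x ⟨h1, h2⟩ ⟨h3, h4⟩
    rcases lt_or_gt_of_ne hij with h | h
    · exact absurd h1 (not_lt.2 (h4 i h))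
    · exact absurd h3 (not_lt.2 (h2 j h))
  have hflip (i : Fin k) : μ (A i) ≤ 2 * μ (A i ∩ B) := by
    let F : EuclideanSpace ℝ (Fin k) ≃ₗᵢ[ℝ] EuclideanSpace ℝ (Fin k) :=
      LinearIsometryEquiv.piLpCongrRight 2 fun j ↦
        if j = i then LinearIsometryEquiv.neg ℝ else LinearIsometryEquiv.refl ℝ ℝ
    have hFi (x : EuclideanSpace ℝ (Fin k)) : F x i = -x i := by simp [F]
    have hFj (x : EuclideanSpace ℝ (Fin k)) (j : Fin k) (hj : j ≠ i) : F x j = x j := by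
      simp [F, hj]
    have hF : MeasurePreserving F μ μ := ⟨F.continuous.measurable, stdGaussian_map F⟩
    have hsub : A i \ B ⊆ F ⁻¹' (A i ∩ B) := by
      rintro x ⟨⟨h1, h2⟩, h3⟩
      refine ⟨⟨?_, fun j hj ↦ ?_⟩, ?_⟩
      · rwa [hFi, abs_neg]
      · rw [hFj x j hj.ne]
        exact h2 j hj
      · have h4 : x - F x = (2 * x i) • EuclideanSpace.single i 1 := by
          ext j
          by_cases hj : j = i
          · subst hj
            simp [hFi]
            ring
          · simp [hFj x j hj, hj]
        have h5 : ‖u (x - F x)‖ ≤ ‖u x‖ + ‖u (F x)‖ := by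
          rw [map_sub]
          exact norm_sub_le _ _
        rw [h4, map_smul, norm_smul, Real.norm_eq_abs, abs_mul, abs_two] at h5
        have h6 : t * c ≤ |x i| * ‖u (EuclideanSpace.single i 1)‖ :=
          mul_le_mul h1.le (hu i) hc (abs_nonneg _)
        simp only [hB, Set.mem_ofPred_eq, not_le] at h3 ⊢
        linarith
    calc μ (A i) = μ (A i ∩ B) + μ (A i \ B) := (measure_inter_add_sdiff _ hBm).symm
      _ ≤ μ (A i ∩ B) + μ (F ⁻¹' (A i ∩ B)) := by gcongr
      _ = 2 * μ (A i ∩ B) := by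
        rw [hF.measure_preimage ((hAm i).inter hBm).nullMeasurableSet, two_mul]
  have hcover : {x : EuclideanSpace ℝ (Fin k) | ∀ i, |x i| ≤ t}ᶜ ⊆ ⋃ i, A i := by
    intro x hx
    simp only [Set.mem_compl_iff, Set.mem_ofPred_eq, not_forall, not_le] at hx
    obtain ⟨i, hi, hmin⟩ := WellFounded.has_min (wellFounded_lt (α := Fin k)) {i | t < |x i|} hx
    exact Set.mem_iUnion.2 ⟨i, hi, fun j hj ↦ not_lt.1 fun h ↦ hmin j h hj⟩
  have hmeas : MeasurableSet {x : EuclideanSpace ℝ (Fin k) | ∀ i, |x i| ≤ t} := by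
    rw [Set.ofPred_forall]
    exact MeasurableSet.iInter fun i ↦ measurableSet_le (by fun_prop) (by fun_prop)
  have hhalf : 2⁻¹ ≤ μ (⋃ i, A i) := by
    refine le_trans ?_ (measure_mono hcover)
    rw [prob_compl_eq_one_sub hmeas]
    calc (2⁻¹ : ENNReal) = 1 - 2⁻¹ := ENNReal.one_sub_inv_two.symm
      _ ≤ _ := tsub_le_tsub_left ht 1
  have hle : (2⁻¹ : ENNReal) ≤ 2 * μ B := by
    calc (2⁻¹ : ENNReal) ≤ μ (⋃ i, A i) := hhalf
      _ = ∑ i, μ (A i) := by rw [measure_iUnion hdisj hAm, tsum_fintype]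
      _ ≤ ∑ i, 2 * μ (A i ∩ B) := Finset.sum_le_sum fun i _ ↦ hflip i
      _ = 2 * μ (⋃ i, A i ∩ B) := by
        rw [← Finset.mul_sum, measure_iUnion
          (fun i j hij ↦ (hdisj hij).mono Set.inter_subset_left Set.inter_subset_left)
          (fun i ↦ (hAm i).inter hBm), tsum_fintype]
      _ ≤ 2 * μ B := by
        gcongr
        exact Set.iUnion_subset fun i ↦ Set.inter_subset_right
  have h4 : (4⁻¹ : ENNReal) = 2⁻¹ * 2⁻¹ := by
    rw [← ENNReal.mul_inv (by simp) (by simp)]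
    norm_num
  rw [h4]
  calc (2⁻¹ * 2⁻¹ : ENNReal) ≤ 2⁻¹ * (2 * μ B) := by gcongr
    _ = μ B := by rw [← mul_assoc, ENNReal.inv_mul_cancel (by simp) (by simp), one_mul]

end Concentration

section Dvoretzky

variable {V : Type*} [NormedAddCommGroup V] [NormedSpace ℝ V]

theorem exists_contraction_concentrated (hV : ¬ FiniteDimensional ℝ V) {K : ℝ} (hK : 0 < K) :
    ∃ (k : ℕ) (u : EuclideanSpace ℝ (Fin k) →L[ℝ] V) (M : ℝ), K ≤ M ∧
      stdGaussian (EuclideanSpace ℝ (Fin k)) {x | M / 4 ≤ |‖u x‖ - M|}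
        ≤ ENNReal.ofReal (1040 / M ^ 2) := by
  obtain ⟨k, hk⟩ := exists_stdGaussian_forall_abs_le_le_half (5 / 2 * K)
  obtain ⟨u, hu1, hu2⟩ := exists_contraction_two_fifths_le hV k
  have hquarter := quarter_le_stdGaussian_le_norm u (by norm_num) hu2 hk
  rw [show 2 / 5 * (5 / 2 * K) = K by ring] at hquarter
  set μ := stdGaussian (EuclideanSpace ℝ (Fin k))
  have hsq := lintegral_norm_sub_norm_sq_le u hu1
  have hcont : Continuous fun p : EuclideanSpace ℝ (Fin k) × EuclideanSpace ℝ (Fin k) ↦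
      ENNReal.ofReal ((‖u p.2‖ - ‖u p.1‖) ^ 2) :=
    ENNReal.continuous_ofReal.comp (by fun_prop)
  rw [lintegral_prod _ hcont.measurable.aemeasurable] at hsq
  have hB : MeasurableSet {x | K ≤ ‖u x‖} :=
    measurableSet_le measurable_const u.continuous.norm.measurable
  obtain ⟨y, hyK, hy⟩ : ∃ y, K ≤ ‖u y‖ ∧
      ∫⁻ x, ENNReal.ofReal ((‖u x‖ - ‖u y‖) ^ 2) ∂μ ≤ ENNReal.ofReal 65 := by
    by_contra! hcon
    have h1 : ∫⁻ _ in {x | K ≤ ‖u x‖}, ENNReal.ofReal 65 ∂μ ≤ ENNReal.ofReal 16 :=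
      calc ∫⁻ _ in {x | K ≤ ‖u x‖}, ENNReal.ofReal 65 ∂μ
          ≤ ∫⁻ y in {x | K ≤ ‖u x‖}, ∫⁻ x, ENNReal.ofReal ((‖u x‖ - ‖u y‖) ^ 2) ∂μ ∂μ :=
            setLIntegral_mono' hB fun y hy ↦ (hcon y hy).le
        _ ≤ ∫⁻ y, ∫⁻ x, ENNReal.ofReal ((‖u x‖ - ‖u y‖) ^ 2) ∂μ ∂μ :=
            setLIntegral_le_lintegral _ _
        _ ≤ _ := hsq
    rw [setLIntegral_const] at h1
    have h2 : ENNReal.ofReal 65 * ENNReal.ofReal 4⁻¹ ≤ ENNReal.ofReal 16 := by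
      refine le_trans ?_ h1
      gcongr
      rwa [ENNReal.ofReal_inv_of_pos (by norm_num), ENNReal.ofReal_ofNat]
    rw [← ENNReal.ofReal_mul (by norm_num), ENNReal.ofReal_le_ofReal_iff (by norm_num)] at h2
    norm_num at h2
  set M := ‖u y‖
  have hM : 0 < M := hK.trans_le hyK
  refine ⟨k, u, M, hyK, ?_⟩
  have hsub : {x | M / 4 ≤ |‖u x‖ - M|}
      ⊆ {x | ENNReal.ofReal (M ^ 2 / 16) ≤ ENNReal.ofReal ((‖u x‖ - M) ^ 2)} := by
    intro x hx
    simp only [Set.mem_ofPred_eq] at hx ⊢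
    refine ENNReal.ofReal_le_ofReal ?_
    rw [← sq_abs (‖u x‖ - M)]
    nlinarith
  have hcont' : Continuous fun x ↦ ENNReal.ofReal ((‖u x‖ - M) ^ 2) :=
    ENNReal.continuous_ofReal.comp (by fun_prop)
  calc μ {x | M / 4 ≤ |‖u x‖ - M|}
      ≤ μ {x | ENNReal.ofReal (M ^ 2 / 16) ≤ ENNReal.ofReal ((‖u x‖ - M) ^ 2)} :=
        measure_mono hsub
    _ ≤ (∫⁻ x, ENNReal.ofReal ((‖u x‖ - M) ^ 2) ∂μ) / ENNReal.ofReal (M ^ 2 / 16) :=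
        meas_ge_le_lintegral_div hcont'.measurable.aemeasurable (by simpa using by positivity)
          ENNReal.ofReal_ne_top
    _ ≤ ENNReal.ofReal 65 / ENNReal.ofReal (M ^ 2 / 16) := by gcongr
    _ = ENNReal.ofReal (1040 / M ^ 2) := by
        rw [← ENNReal.ofReal_div_of_pos (by positivity)]
        congr 1
        field_simp
        norm_num

theorem bounds_of_quarter_net {n : ℕ} (W : EuclideanSpace ℝ (Fin n) →L[ℝ] V) {M : ℝ} (hM : 0 < M)
    {s : Set (EuclideanSpace ℝ (Fin n))}
    (hs : Metric.sphere (0 : EuclideanSpace ℝ (Fin n)) 1 ⊆ ⋃ x ∈ s, Metric.ball x (1 / 4))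
    (hW : ∀ a ∈ s, |‖W a‖ - M| < M / 4) (a : EuclideanSpace ℝ (Fin n)) :
    M / 3 * ‖a‖ ≤ ‖W a‖ ∧ ‖W a‖ ≤ 5 * M / 3 * ‖a‖ := by
  have hnear (a : EuclideanSpace ℝ (Fin n)) (ha : ‖a‖ = 1) :
      3 * M / 4 - ‖W‖ / 4 ≤ ‖W a‖ ∧ ‖W a‖ ≤ 5 * M / 4 + ‖W‖ / 4 := by
    obtain ⟨b, hb, hab⟩ : ∃ b ∈ s, a ∈ Metric.ball b (1 / 4) := by
      simpa using hs (show a ∈ Metric.sphere 0 1 by simpa using ha)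
    have h1 : ‖W a - W b‖ ≤ ‖W‖ / 4 := by
      rw [← map_sub]
      calc ‖W (a - b)‖ ≤ ‖W‖ * ‖a - b‖ := W.le_opNorm _
        _ ≤ ‖W‖ * (1 / 4) := by
          gcongr
          exact (mem_ball_iff_norm.1 hab).le
        _ = ‖W‖ / 4 := by ring
    have h2 := abs_lt.1 (hW b hb)
    have h3 := abs_le.1 (abs_norm_sub_norm_le (W a) (W b))
    constructor <;> linarith
  have hnorm : ‖W‖ ≤ 5 * M / 3 := by
    have := W.opNorm_le_of_unit_norm (C := 5 * M / 4 + ‖W‖ / 4) (by positivity)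
      fun a ha ↦ (hnear a ha).2
    linarith
  refine ⟨?_, W.le_of_opNorm_le hnorm a⟩
  rcases eq_or_ne a 0 with rfl | ha
  · simp
  have ha' : 0 < ‖a‖ := norm_pos_iff.2 ha
  have h1 := (hnear (‖a‖⁻¹ • a) (by simp [norm_smul, ha'.ne'])).1
  rw [map_smul, norm_smul, norm_inv, norm_norm] at h1
  have h2 : M / 3 ≤ ‖a‖⁻¹ * ‖W a‖ := by linarith
  rwa [← div_eq_inv_mul, le_div_iff₀ ha'] at h2

/-- A weak form of Dvoretzky's theorem: an infinite-dimensional normed space contains `5`-isomorphic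
copies of all finite-dimensional Euclidean spaces. -/
theorem exists_euclidean_embedding (hV : ¬ FiniteDimensional ℝ V) (n : ℕ) :
    ∃ L : EuclideanSpace ℝ (Fin n) →L[ℝ] V, ∀ a, ‖a‖ ≤ ‖L a‖ ∧ ‖L a‖ ≤ 5 * ‖a‖ := by
  obtain ⟨s, hs1, hs2, hs3⟩ := (isCompact_sphere (0 : EuclideanSpace ℝ (Fin n)) 1).finite_cover_balls
    (e := 1 / 4) (by norm_num)
  lift s to Finset (EuclideanSpace ℝ (Fin n)) using hs2
  obtain ⟨k, u, M, hKM, hM⟩ := exists_contraction_concentrated hV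
    (K := 1040 * (s.card + 1)) (by positivity)
  have hM0 : 0 < M := lt_of_lt_of_le (by positivity) hKM
  let bad : Set (EuclideanSpace ℝ (Fin k)) := {x | M / 4 ≤ |‖u x‖ - M|}
  have hbad : MeasurableSet bad := measurableSet_le measurable_const (by
    have : Continuous fun x ↦ |‖u x‖ - M| := by fun_prop
    exact this.measurable)
  let ν := Measure.pi fun _ : Fin n ↦ stdGaussian (EuclideanSpace ℝ (Fin k))
  have hν : ν (⋃ a ∈ s, (fun w : Fin n → EuclideanSpace ℝ (Fin k) ↦ ∑ j, a j • w j) ⁻¹' bad) < 1 :=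
    calc _ ≤ ∑ a ∈ s, ν ((fun w : Fin n → EuclideanSpace ℝ (Fin k) ↦ ∑ j, a j • w j) ⁻¹' bad) :=
          measure_biUnion_finset_le _ _
      _ ≤ ∑ a ∈ s, ENNReal.ofReal (1040 / M ^ 2) := by
          refine Finset.sum_le_sum fun a ha ↦ ?_
          rw [(measurePreserving_sum_smul_stdGaussian a (by simpa using hs1 ha)).measure_preimage
            hbad.nullMeasurableSet]
          exact hM
      _ = ENNReal.ofReal (s.card * (1040 / M ^ 2)) := by
          rw [Finset.sum_const, nsmul_eq_mul, ENNReal.ofReal_mul (by positivity),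
            ENNReal.ofReal_natCast]
      _ < 1 := by
          rw [ENNReal.ofReal_lt_one, mul_div_assoc', div_lt_one (by positivity)]
          have : (0 : ℝ) ≤ s.card := by positivity
          nlinarith
  obtain ⟨w, hw⟩ : ∃ w, w ∉ ⋃ a ∈ s,
      (fun w : Fin n → EuclideanSpace ℝ (Fin k) ↦ ∑ j, a j • w j) ⁻¹' bad := by
    by_contra! hcon
    rw [Set.eq_univ_of_forall hcon, measure_univ] at hν
    exact lt_irrefl _ hν
  let W : EuclideanSpace ℝ (Fin n) →L[ℝ] V := ∑ j, (EuclideanSpace.proj j).smulRight (u (w j))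
  have hW (a : EuclideanSpace ℝ (Fin n)) : W a = u (∑ j, a j • w j) := by
    simp [W, map_sum]
  have hbounds := bounds_of_quarter_net W hM0 hs3 fun a ha ↦ by
    rw [hW]
    by_contra! hcon
    exact hw (Set.mem_biUnion ha hcon)
  refine ⟨(3 / M) • W, fun a ↦ ?_⟩
  rw [smul_apply, norm_smul, Real.norm_of_nonneg (by positivity), div_mul_eq_mul_div,
    le_div_iff₀ hM0, div_le_iff₀ hM0]
  have := hbounds a
  constructor <;> linarith

end Dvoretzky

section EuclideanDistortion

/-- `E` embeds linearly into a Euclidean space with distortion at most `C`. -/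
def EuclideanDistortionLE (C : ℝ) (E : Type*) [NormedAddCommGroup E] [NormedSpace ℝ E] : Prop :=
  ∃ (m : ℕ) (T : E →ₗ[ℝ] EuclideanSpace ℝ (Fin m)), ∀ e, ‖e‖ ≤ ‖T e‖ ∧ ‖T e‖ ≤ C * ‖e‖

variable {E : Type*} [NormedAddCommGroup E] [NormedSpace ℝ E]

theorem EuclideanDistortionLE.mono {C D : ℝ} (hCD : C ≤ D) (h : EuclideanDistortionLE C E) :
    EuclideanDistortionLE D E := by
  obtain ⟨m, T, hT⟩ := h
  exact ⟨m, T, fun e ↦ ⟨(hT e).1, (hT e).2.trans (by gcongr)⟩⟩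

theorem EuclideanDistortionLE.of_add {C : ℝ} {m n : ℕ} (S : E →ₗ[ℝ] EuclideanSpace ℝ (Fin m))
    (T : E →ₗ[ℝ] EuclideanSpace ℝ (Fin n)) (h1 : ∀ e, ‖e‖ ≤ ‖S e‖ + ‖T e‖)
    (h2 : ∀ e, ‖S e‖ + ‖T e‖ ≤ C * ‖e‖) : EuclideanDistortionLE (2 * C) E := by
  let H := WithLp 2 (EuclideanSpace ℝ (Fin m) × EuclideanSpace ℝ (Fin n))
  let R : E →ₗ[ℝ] H := (WithLp.linearEquiv 2 ℝ _).symm.toLinearMap ∘ₗ S.prod T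
  have hR (e : E) : ‖R e‖ ^ 2 = ‖S e‖ ^ 2 + ‖T e‖ ^ 2 := by
    rw [WithLp.prod_norm_sq_eq_of_L2]
    rfl
  refine ⟨finrank ℝ H,
    (2 : ℝ) • ((stdOrthonormalBasis ℝ H).repr.toLinearEquiv.toLinearMap ∘ₗ R), fun e ↦ ?_⟩
  have hnorm : ‖((2 : ℝ) • ((stdOrthonormalBasis ℝ H).repr.toLinearEquiv.toLinearMap ∘ₗ R)) e‖
      = 2 * ‖R e‖ := by
    rw [LinearMap.smul_apply, norm_smul, Real.norm_two, LinearMap.comp_apply]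
    congr 1
    exact (stdOrthonormalBasis ℝ H).repr.norm_map (R e)
  rw [hnorm]
  have hS := norm_nonneg (S e)
  have hT := norm_nonneg (T e)
  constructor
  · refine (h1 e).trans (le_of_sq_le_sq ?_ (by positivity))
    nlinarith [hR e, sq_nonneg (‖S e‖ - ‖T e‖)]
  · have : ‖R e‖ ≤ ‖S e‖ + ‖T e‖ := le_of_sq_le_sq (by nlinarith [hR e]) (by positivity)
    linarith [h2 e]

theorem exists_euclideanDistortionLE [FiniteDimensional ℝ E] :
    ∃ C : ℝ, 0 < C ∧ EuclideanDistortionLE C E := by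
  let e : E ≃L[ℝ] EuclideanSpace ℝ (Fin (finrank ℝ E)) := toEuclidean
  set c := ‖(e.symm : EuclideanSpace ℝ (Fin (finrank ℝ E)) →L[ℝ] E)‖
  set d := ‖(e : E →L[ℝ] EuclideanSpace ℝ (Fin (finrank ℝ E)))‖
  refine ⟨(c + 1) * (d + 1), by positivity, finrank ℝ E, (c + 1) • e.toLinearEquiv.toLinearMap,
    fun x ↦ ?_⟩
  have h0 : ‖((c + 1) • e.toLinearEquiv.toLinearMap) x‖ = (c + 1) * ‖e x‖ := by
    rw [LinearMap.smul_apply, norm_smul, Real.norm_of_nonneg (by positivity)]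
    rfl
  rw [h0]
  constructor
  · calc ‖x‖ = ‖e.symm (e x)‖ := by simp
      _ ≤ c * ‖e x‖ := (e.symm : EuclideanSpace ℝ (Fin (finrank ℝ E)) →L[ℝ] E).le_opNorm _
      _ ≤ (c + 1) * ‖e x‖ := by gcongr; linarith
  · rw [mul_assoc]
    gcongr
    calc ‖e x‖ ≤ d * ‖x‖ := (e : E →L[ℝ] EuclideanSpace ℝ (Fin (finrank ℝ E))).le_opNorm _
      _ ≤ (d + 1) * ‖x‖ := by gcongr; linarith

variable {X : Type*} [NormedAddCommGroup X] [NormedSpace ℝ X]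

/-- Mazur's lemma: a finite-dimensional subspace admits an almost orthogonal closed subspace of
finite codimension. -/
theorem exists_cofg_isClosed_norm_le (S : Submodule ℝ X) [FiniteDimensional ℝ S] :
    ∃ Z : Submodule ℝ X, Z.CoFG ∧ IsClosed (Z : Set X) ∧
      ∀ s ∈ S, ∀ z ∈ Z, ‖s‖ ≤ 2 * ‖s + z‖ := by
  obtain ⟨t, ht1, ht2, ht3⟩ := (isCompact_sphere (0 : S) 1).finite_cover_balls
    (e := 1 / 2) (by norm_num)
  lift t to Finset S using ht2
  choose f hf1 hf2 using fun x : X ↦ exists_dual_vector'' ℝ x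
  let F : X →L[ℝ] (t → ℝ) := ContinuousLinearMap.pi fun b ↦ f (b : S)
  have hF (z : X) (hz : z ∈ F.ker) (b : S) (hb : b ∈ t) : f b z = 0 :=
    congrFun (LinearMap.mem_ker.1 hz) ⟨b, hb⟩
  refine ⟨F.ker, Submodule.CoFG.ker _, F.isClosed_ker, fun s hs z hz ↦ ?_⟩
  rcases eq_or_ne s 0 with rfl | hs0
  · simp
  have hs' : 0 < ‖s‖ := norm_pos_iff.2 hs0
  obtain ⟨b, hb, hsb⟩ : ∃ b ∈ t, ‖s‖⁻¹ • (⟨s, hs⟩ : S) ∈ Metric.ball b (1 / 2) := by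
    have : ‖s‖⁻¹ • (⟨s, hs⟩ : S) ∈ Metric.sphere 0 1 := by simp [norm_smul, hs0]
    simpa using ht3 this
  have hb1 : ‖(b : X)‖ = 1 := by simpa using ht1 hb
  have h1 : f b (b - ‖s‖⁻¹ • s) ≤ 1 / 2 := by
    have h2 : ‖(b : X) - ‖s‖⁻¹ • s‖ ≤ 1 / 2 := by
      rw [norm_sub_rev]
      exact (mem_ball_iff_norm.1 hsb).le
    calc f b (b - ‖s‖⁻¹ • s) ≤ ‖f b (b - ‖s‖⁻¹ • s)‖ := Real.le_norm_self _
      _ ≤ 1 * ‖(b : X) - ‖s‖⁻¹ • s‖ := (f b).le_of_opNorm_le (hf1 b) _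
      _ ≤ 1 / 2 := by linarith
  have h3 : f b s ≤ ‖s + z‖ := by
    calc f b s = f b (s + z) := by rw [map_add, hF z hz b hb, add_zero]
      _ ≤ ‖f b (s + z)‖ := Real.le_norm_self _
      _ ≤ 1 * ‖s + z‖ := (f b).le_of_opNorm_le (hf1 b) _
      _ = ‖s + z‖ := one_mul _
  rw [map_sub, hf2, map_smul, smul_eq_mul, hb1, RCLike.ofReal_real_eq_id, id] at h1
  have h4 : 1 / 2 ≤ ‖s‖⁻¹ * f b s := by linarith
  rw [← div_eq_inv_mul, le_div_iff₀ hs'] at h4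
  linarith

/-- `W` admits a linear projection onto `G` of norm at most `K`. -/
def HasProjectionLE (K : ℝ) (W G : Submodule ℝ X) : Prop :=
  ∃ r : W →ₗ[ℝ] X, (∀ w, r w ∈ G) ∧ (∀ w : W, (w : X) ∈ G → r w = w) ∧ ∀ w, ‖r w‖ ≤ K * ‖w‖

theorem Submodule.CoFG.not_finiteDimensional (hX : ¬ FiniteDimensional ℝ X) {Z : Submodule ℝ X}
    (hZ : Z.CoFG) : ¬ FiniteDimensional ℝ Z := by
  intro h
  obtain ⟨T, hT⟩ := Z.exists_isCompl
  have h1 : (Z ⊔ T).FG := Submodule.FG.sup (Module.Finite.iff_fg.1 h) (hZ.fg_of_isCompl hT)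
  rw [hT.sup_eq_top] at h1
  exact hX (Module.finite_def.2 h1)

/-- Projections in the span of `E` and of an almost orthogonal copy of a Euclidean space onto the
graph of a Euclidean embedding of `E` improve the distortion of that embedding. -/
theorem EuclideanDistortionLE.improve (hX : ¬ FiniteDimensional ℝ X) {Z : Submodule ℝ X}
    (hZ : Z.CoFG) {K : ℝ} (hK : 0 < K)
    (hproj : ∀ W ≤ Z, FiniteDimensional ℝ W → ∀ G ≤ W, HasProjectionLE K W G)
    {E : Submodule ℝ X} [FiniteDimensional ℝ E] (hE : E ≤ Z) {d : ℝ} (hd : 0 < d)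
    (h : EuclideanDistortionLE (d ^ 2) E) : EuclideanDistortionLE (26 * K * d) E := by
  obtain ⟨m, T, hT⟩ := h
  let S : E →ₗ[ℝ] EuclideanSpace ℝ (Fin m) := d⁻¹ • T
  have hS (e : E) : ‖e‖ ≤ d * ‖S e‖ ∧ ‖S e‖ ≤ d * ‖e‖ := by
    have h1 : ‖S e‖ = d⁻¹ * ‖T e‖ := by
      rw [LinearMap.smul_apply, norm_smul, Real.norm_of_nonneg (by positivity)]
    rw [h1]
    constructor
    · rw [mul_inv_cancel_left₀ hd.ne']
      exact (hT e).1
    · rw [inv_mul_le_iff₀ hd]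
      linarith [(hT e).2]
  obtain ⟨Z', hZ'1, -, hZ'2⟩ := exists_cofg_isClosed_norm_le E
  obtain ⟨L, hL⟩ := exists_euclidean_embedding ((hZ.inf hZ'1).not_finiteDimensional hX) m
  let J : EuclideanSpace ℝ (Fin m) →ₗ[ℝ] X := (Z ⊓ Z').subtype ∘ₗ L.toLinearMap
  have hJmem (a) : J a ∈ Z ⊓ Z' := (L a).2
  have hJ (a) : ‖a‖ ≤ ‖J a‖ ∧ ‖J a‖ ≤ 5 * ‖a‖ := hL a
  let W : Submodule ℝ X := E ⊔ J.range
  have hW : W ≤ Z := sup_le hE (by rintro _ ⟨a, rfl⟩; exact (hJmem a).1)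
  let g : E →ₗ[ℝ] X := E.subtype + J ∘ₗ S
  have hg (e : E) : ‖e‖ ≤ 2 * ‖g e‖ := hZ'2 e e.2 _ (hJmem _).2
  have hginj : Function.Injective g := by
    rw [injective_iff_map_eq_zero]
    intro e he
    have := hg e
    rw [he, norm_zero, mul_zero] at this
    exact norm_le_zero_iff.1 this
  have hEW (e : E) : (e : X) ∈ W := Submodule.mem_sup_left e.2
  have hJW (a) : J a ∈ W := Submodule.mem_sup_right ⟨a, rfl⟩
  have hG : g.range ≤ W := by
    rintro _ ⟨e, rfl⟩
    exact add_mem (hEW e) (hJW _)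
  obtain ⟨r, hr1, hr2, hr3⟩ := hproj W hW inferInstance g.range hG
  let q : W →ₗ[ℝ] E := (LinearEquiv.ofInjective g hginj).symm.toLinearMap ∘ₗ r.codRestrict _ hr1
  have hgq (w : W) : g (q w) = r w :=
    congrArg Subtype.val ((LinearEquiv.ofInjective g hginj).apply_symm_apply ⟨r w, hr1 w⟩)
  have hq (w : W) : ‖q w‖ ≤ 2 * K * ‖w‖ := by
    have := hg (q w)
    rw [hgq] at this
    linarith [hr3 w]
  let A : E →ₗ[ℝ] E := q ∘ₗ Submodule.inclusion le_sup_left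
  let B : EuclideanSpace ℝ (Fin m) →ₗ[ℝ] E := q ∘ₗ J.codRestrict W hJW
  have hAB (e : E) : A e + B (S e) = e := by
    apply hginj
    have h1 : A e + B (S e) = q ⟨g e, hG ⟨e, rfl⟩⟩ := (map_add q _ _).symm
    rw [h1, hgq, hr2 _ ⟨e, rfl⟩]
  have hA (e : E) : ‖A e‖ ≤ 2 * K * ‖e‖ := hq _
  have hB (a) : ‖B a‖ ≤ 10 * K * ‖a‖ := by
    calc ‖B a‖ ≤ 2 * K * ‖J a‖ := hq _
      _ ≤ 2 * K * (5 * ‖a‖) := by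
        gcongr
        exact (hJ a).2
      _ = 10 * K * ‖a‖ := by ring
  have hSA (e : E) : ‖S (A e)‖ ≤ 3 * K * ‖e‖ := by
    have h1 : g (A e) = r (Submodule.inclusion le_sup_left e) := hgq _
    have h2 : ‖g (A e)‖ ≤ K * ‖e‖ := by
      rw [h1]
      exact hr3 _
    have h3 : J (S (A e)) = g (A e) - A e := by simp [g]
    have h4 : ‖J (S (A e))‖ ≤ ‖g (A e)‖ + ‖A e‖ := by
      rw [h3]
      exact norm_sub_le _ _
    linarith [(hJ (S (A e))).1, hA e]
  rw [show 26 * K * d = 2 * (13 * K * d) by ring]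
  have h1 (e : E) : ‖(d • (S ∘ₗ A)) e‖ = d * ‖S (A e)‖ := by
    rw [LinearMap.smul_apply, norm_smul, Real.norm_of_nonneg hd.le, LinearMap.comp_apply]
  have h2 (e : E) : ‖((10 * K) • S) e‖ = 10 * K * ‖S e‖ := by
    rw [LinearMap.smul_apply, norm_smul, Real.norm_of_nonneg (by positivity)]
  refine EuclideanDistortionLE.of_add (d • (S ∘ₗ A)) ((10 * K) • S) (fun e ↦ ?_) fun e ↦ ?_
  · rw [h1, h2]
    calc ‖e‖ = ‖A e + B (S e)‖ := by rw [hAB]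
      _ ≤ ‖A e‖ + ‖B (S e)‖ := norm_add_le _ _
      _ ≤ d * ‖S (A e)‖ + 10 * K * ‖S e‖ := add_le_add (hS _).1 (hB _)
  · rw [h1, h2]
    calc d * ‖S (A e)‖ + 10 * K * ‖S e‖ ≤ d * (3 * K * ‖e‖) + 10 * K * (d * ‖e‖) := by
          gcongr
          · exact hSA e
          · exact (hS e).2
      _ = 13 * K * d * ‖e‖ := by ring

theorem euclideanDistortionLE_of_hasProjectionLE (hX : ¬ FiniteDimensional ℝ X)
    {Z : Submodule ℝ X} (hZ : Z.CoFG) {K : ℝ} (hK : 0 < K)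
    (hproj : ∀ W ≤ Z, FiniteDimensional ℝ W → ∀ G ≤ W, HasProjectionLE K W G)
    {E : Submodule ℝ X} [FiniteDimensional ℝ E] (hE : E ≤ Z) :
    EuclideanDistortionLE ((52 * K) ^ 2) E := by
  have key (n : ℕ) : EuclideanDistortionLE (2 ^ n * (52 * K) ^ 2) E →
      EuclideanDistortionLE ((52 * K) ^ 2) E := by
    induction n with
    | zero => simp
    | succ n ih =>
      intro h
      refine ih ?_
      have h1 : 2 ^ (n + 1) * (52 * K) ^ 2 = (√2 ^ (n + 1) * (52 * K)) ^ 2 := by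
        rw [mul_pow (√2 ^ (n + 1)), ← pow_mul, mul_comm (n + 1), pow_mul, Real.sq_sqrt (by norm_num)]
      rw [h1] at h
      refine (h.improve hX hZ hK hproj hE (by positivity)).mono ?_
      have h2 : √2 ^ (n + 1) ≤ 2 ^ (n + 1) := by
        gcongr
        exact Real.sqrt_le_iff.2 (by norm_num)
      calc 26 * K * (√2 ^ (n + 1) * (52 * K)) ≤ 26 * K * (2 ^ (n + 1) * (52 * K)) := by gcongr
        _ = 2 ^ n * (52 * K) ^ 2 := by ring
  obtain ⟨C, -, hC⟩ := exists_euclideanDistortionLE (E := E)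
  obtain ⟨n, hn⟩ := pow_unbounded_of_one_lt (C / (52 * K) ^ 2) one_lt_two
  rw [div_lt_iff₀ (by positivity)] at hn
  exact key n (hC.mono hn.le)

/-- Uniform Euclidean distortion passes from a closed subspace of finite codimension to the whole
space. -/
theorem exists_uniform_euclideanDistortionLE_of_cofg {Z : Submodule ℝ X} (hZ : Z.CoFG)
    (hZc : IsClosed (Z : Set X)) {C : ℝ}
    (h : ∀ E ≤ Z, FiniteDimensional ℝ E → EuclideanDistortionLE C E) :
    ∃ D, ∀ E : Submodule ℝ X, FiniteDimensional ℝ E → EuclideanDistortionLE D E := by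
  obtain ⟨P, hP⟩ := Submodule.ClosedComplemented.of_finiteDimensional_quotient hZc (hq := hZ)
  have hker : FiniteDimensional ℝ P.ker := by
    refine Module.Finite.iff_fg.2 (hZ.fg_of_disjoint ?_)
    rw [Submodule.disjoint_def]
    intro x hx hxZ
    have hx' : P x = 0 := LinearMap.mem_ker.1 hx
    simpa [hx'] using (congrArg Subtype.val (hP ⟨x, hxZ⟩)).symm
  obtain ⟨CF, hCF, n, T, hT⟩ := exists_euclideanDistortionLE (E := P.ker)
  have hQ (x : X) : x - P x ∈ P.ker := by
    refine LinearMap.mem_ker.2 ?_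
    change P (x - P x) = 0
    rw [map_sub, hP, sub_self]
  let Q : X →ₗ[ℝ] P.ker := (LinearMap.id - Z.subtype ∘ₗ P.toLinearMap).codRestrict _ hQ
  refine ⟨2 * (|C| * ‖P‖ + CF * (1 + ‖P‖)), fun E hE ↦ ?_⟩
  let P' : X →ₗ[ℝ] X := Z.subtype ∘ₗ P.toLinearMap
  obtain ⟨m, S, hS⟩ := (h (E.map P') (by rintro _ ⟨x, -, rfl⟩; exact (P x).2)
    inferInstance).mono (le_abs_self C)
  let R : E →ₗ[ℝ] E.map P' := (P' ∘ₗ E.subtype).codRestrict _ fun e ↦ ⟨e, e.2, rfl⟩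
  have hR (e : E) : ‖R e‖ ≤ ‖P‖ * ‖e‖ := P.le_opNorm e
  have hQn (e : E) : ‖Q e‖ ≤ (1 + ‖P‖) * ‖e‖ :=
    calc ‖Q e‖ = ‖(e : X) - P e‖ := rfl
      _ ≤ ‖(e : X)‖ + ‖(P e : X)‖ := norm_sub_le _ _
      _ ≤ (1 + ‖P‖) * ‖e‖ := by
        have := hR e
        rw [add_mul, one_mul]
        exact add_le_add le_rfl this
  refine EuclideanDistortionLE.of_add (S ∘ₗ R) (T ∘ₗ Q ∘ₗ E.subtype) (fun e ↦ ?_) fun e ↦ ?_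
  · calc ‖e‖ = ‖(P e : X) + (e - P e)‖ := by simp
      _ ≤ ‖R e‖ + ‖Q e‖ := norm_add_le _ _
      _ ≤ _ := add_le_add (hS _).1 (hT _).1
  · calc _ ≤ |C| * ‖R e‖ + CF * ‖Q e‖ := add_le_add (hS _).2 (hT _).2
      _ ≤ |C| * (‖P‖ * ‖e‖) + CF * ((1 + ‖P‖) * ‖e‖) := by
        gcongr
        · exact hR e
        · exact hQn e
      _ = _ := by ring

end EuclideanDistortion

section GlidingHump

variable {X : Type*} [NormedAddCommGroup X] [NormedSpace ℝ X]

/-- If every closed subspace of finite codimension contains badly complemented pairs, then such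
pairs can be found along a finite-dimensional decomposition. -/
theorem exists_seq_not_hasProjectionLE
    (hbad : ∀ Z : Submodule ℝ X, Z.CoFG → IsClosed (Z : Set X) → ∀ n : ℕ,
      ∃ W ≤ Z, FiniteDimensional ℝ W ∧ ∃ G ≤ W, ¬ HasProjectionLE (n + 1 : ℝ) W G) :
    ∃ W G S Z : ℕ → Submodule ℝ X, (∀ n, FiniteDimensional ℝ (W n)) ∧
      (∀ n, FiniteDimensional ℝ (S n)) ∧ (∀ n, IsClosed (Z n : Set X)) ∧ Monotone S ∧ Antitone Z ∧
      (∀ n, G n ≤ W n) ∧ (∀ n, W n ≤ Z n) ∧ (∀ n, W n ≤ S (n + 1)) ∧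
      (∀ n, ∀ s ∈ S n, ∀ z ∈ Z n, ‖s‖ ≤ 2 * ‖s + z‖) ∧
      ∀ n : ℕ, ¬ HasProjectionLE (n + 1 : ℝ) (W n) (G n) := by
  have hbad' (Z : Submodule ℝ X) (n : ℕ) : ∃ W G : Submodule ℝ X,
      Z.CoFG → IsClosed (Z : Set X) → W ≤ Z ∧ FiniteDimensional ℝ W ∧ G ≤ W ∧
        ¬ HasProjectionLE (n + 1 : ℝ) W G := by
    by_cases h : Z.CoFG ∧ IsClosed (Z : Set X)
    · obtain ⟨W, h1, h2, G, h3, h4⟩ := hbad Z h.1 h.2 n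
      exact ⟨W, G, fun _ _ ↦ ⟨h1, h2, h3, h4⟩⟩
    · exact ⟨⊥, ⊥, fun h1 h2 ↦ absurd ⟨h1, h2⟩ h⟩
  have hM (S : Submodule ℝ X) : ∃ Z : Submodule ℝ X, FiniteDimensional ℝ S → Z.CoFG ∧
      IsClosed (Z : Set X) ∧ ∀ s ∈ S, ∀ z ∈ Z, ‖s‖ ≤ 2 * ‖s + z‖ := by
    by_cases h : FiniteDimensional ℝ S
    · obtain ⟨Z, hZ⟩ := exists_cofg_isClosed_norm_le S
      exact ⟨Z, fun _ ↦ hZ⟩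
    · exact ⟨⊥, fun h' ↦ absurd h' h⟩
  choose W G hWG using hbad'
  choose M hM using hM
  let st : ℕ → Submodule ℝ X × Submodule ℝ X := fun n ↦ Nat.rec (⊤, ⊥)
    (fun n p ↦ (p.1 ⊓ M (p.2 ⊔ W p.1 n), p.2 ⊔ W p.1 n)) n
  let Z (n : ℕ) : Submodule ℝ X := (st n).1
  let S (n : ℕ) : Submodule ℝ X := (st n).2
  have hZs (n : ℕ) : Z (n + 1) = Z n ⊓ M (S (n + 1)) := rfl
  have hSs (n : ℕ) : S (n + 1) = S n ⊔ W (Z n) n := rfl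
  have hinv (n : ℕ) : (Z n).CoFG ∧ IsClosed (Z n : Set X) ∧ FiniteDimensional ℝ (S n) := by
    induction n with
    | zero => exact ⟨Submodule.CoFG.top, isClosed_univ, inferInstanceAs (FiniteDimensional ℝ
        (⊥ : Submodule ℝ X))⟩
    | succ n ih =>
      obtain ⟨h1, h2, h3⟩ := ih
      have h4 := (hWG (Z n) n h1 h2).2.1
      have h5 : FiniteDimensional ℝ (S (n + 1)) := by
        rw [hSs]
        infer_instance
      obtain ⟨h6, h7, -⟩ := hM _ h5
      exact ⟨h1.inf h6, h2.inter h7, h5⟩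
  have hW (n : ℕ) := hWG (Z n) n (hinv n).1 (hinv n).2.1
  refine ⟨fun n ↦ W (Z n) n, fun n ↦ G (Z n) n, S, Z, fun n ↦ (hW n).2.1, fun n ↦ (hinv n).2.2,
    fun n ↦ (hinv n).2.1, monotone_nat_of_le_succ fun n ↦ le_sup_left,
    antitone_nat_of_succ_le fun n ↦ inf_le_left, fun n ↦ (hW n).2.2.1, fun n ↦ (hW n).1,
    fun n ↦ le_sup_right, fun n ↦ ?_, fun n ↦ (hW n).2.2.2⟩
  cases n with
  | zero =>
    intro s hs z _
    have : s = 0 := (Submodule.mem_bot ℝ).1 hs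
    simp [this]
  | succ n => exact fun s hs z hz ↦ (hM _ (hinv (n + 1)).2.2).2.2 s hs z hz.2

theorem exists_projection_of_norm_le {A B : Submodule ℝ X} {c : ℝ}
    (h : ∀ a ∈ A, ∀ b ∈ B, ‖b‖ ≤ c * ‖a + b‖) :
    ∃ Q : X →ₗ[ℝ] X, (∀ x, Q x ∈ B) ∧ (∀ b ∈ B, Q b = b) ∧ ∀ y ∈ A ⊔ B, ‖Q y‖ ≤ c * ‖y‖ := by
  have hdisj : Disjoint A B := by
    rw [Submodule.disjoint_def]
    intro x hA hB
    simpa using h (-x) (neg_mem hA) x hB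
  obtain ⟨A', hA', hc⟩ := hdisj.exists_isCompl
  refine ⟨B.projection A' hc.symm, fun x ↦ Submodule.projection_apply_mem _ x,
    fun b hb ↦ Submodule.projection_apply_of_mem_left _ hb, fun y hy ↦ ?_⟩
  obtain ⟨a, ha, b, hb, rfl⟩ := Submodule.mem_sup.1 hy
  rw [map_add, Submodule.projection_apply_of_mem_right _ (hA' ha),
    Submodule.projection_apply_of_mem_left _ hb, zero_add]
  exact h a ha b hb

theorem exists_uniform_euclideanDistortionLE (hX : ¬ FiniteDimensional ℝ X)
    (h : ∀ Y : Submodule ℝ X, IsClosed (Y : Set X) →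
      ∃ lam : ℝ, ∀ F : Submodule ℝ X, FiniteDimensional ℝ F →
        ∃ r : F →L[ℝ] Y, ‖r‖ ≤ lam ∧ ∀ (y : Y) (hy : (y : X) ∈ F), r ⟨(y : X), hy⟩ = y) :
    ∃ D, ∀ E : Submodule ℝ X, FiniteDimensional ℝ E → EuclideanDistortionLE D E := by
  by_contra hcon
  obtain ⟨W, G, S, Z, hW, hS, hZ, hSmono, hZanti, hGW, hWZ, hWS, hSZ, hbad⟩ :=
    exists_seq_not_hasProjectionLE (X := X) fun Z hZ hZc n ↦ by
      by_contra! hgood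
      exact hcon (exists_uniform_euclideanDistortionLE_of_cofg hZ hZc fun E hE _ ↦
        euclideanDistortionLE_of_hasProjectionLE hX hZ (K := n + 1) (by positivity) hgood hE)
  obtain ⟨lam, hlam⟩ := h (⨆ n, G n).topologicalClosure
    (Submodule.isClosed_topologicalClosure _)
  obtain ⟨n, hn⟩ := exists_nat_ge (6 * lam)
  have hGfin : FiniteDimensional ℝ (G n) := Submodule.finiteDimensional_of_le (hGW n)
  have hY : (⨆ n, G n).topologicalClosure ≤ (S n ⊔ Z (n + 1)) ⊔ G n := by
    refine Submodule.topologicalClosure_minimal _ (iSup_le fun j ↦ ?_) ?_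
    · rcases lt_trichotomy j n with hj | rfl | hj
      · exact ((hGW j).trans ((hWS j).trans (hSmono hj))).trans (le_sup_left.trans le_sup_left)
      · exact le_sup_right
      · exact ((hGW j).trans ((hWZ j).trans (hZanti hj))).trans (le_sup_right.trans le_sup_left)
    · rw [sup_comm (S n), sup_assoc]
      exact Submodule.isClosed_sup_finiteDimensional _ _ (hZ _)
  obtain ⟨Q, hQ1, hQ2, hQ3⟩ := exists_projection_of_norm_le (A := S n ⊔ Z (n + 1)) (B := G n)
      (c := 6) fun a ha g hg ↦ by
    obtain ⟨s, hs, z, hz, rfl⟩ := Submodule.mem_sup.1 ha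
    have h1 : ‖s‖ ≤ 2 * ‖s + g‖ := hSZ n s hs g (hWZ n (hGW n hg))
    have h2 : ‖s + g‖ ≤ 2 * ‖s + g + z‖ :=
      hSZ (n + 1) _ (add_mem (hSmono n.le_succ hs) (hWS n (hGW n hg))) z hz
    have h3 : ‖g‖ ≤ ‖s + g‖ + ‖s‖ := by
      simpa using norm_sub_le (s + g) s
    rw [show s + z + g = s + g + z by abel]
    linarith
  obtain ⟨r, hr1, hr2⟩ := hlam (W n) (hW n)
  refine hbad n ⟨Q ∘ₗ Submodule.subtype _ ∘ₗ r.toLinearMap, fun w ↦ hQ1 _, fun w hw ↦ ?_,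
    fun w ↦ ?_⟩
  · have h1 : (w : X) ∈ (⨆ n, G n).topologicalClosure :=
      Submodule.le_topologicalClosure _ (Submodule.mem_iSup_of_mem n hw)
    have h2 : r w = ⟨w, h1⟩ := hr2 ⟨w, h1⟩ w.2
    change Q (r w : X) = w
    rw [h2]
    exact hQ2 _ hw
  · calc ‖Q (r w : X)‖ ≤ 6 * ‖(r w : X)‖ := hQ3 _ (hY (r w).2)
      _ ≤ 6 * (lam * ‖w‖) := by
        gcongr
        exact r.le_of_opNorm_le hr1 w
      _ = 6 * lam * ‖w‖ := by ring
      _ ≤ (n + 1) * ‖w‖ := by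
        gcongr
        linarith

end GlidingHump

section UltraproductForm

variable {X : Type*} [NormedAddCommGroup X] [NormedSpace ℝ X]

/-- A space whose finite-dimensional subspaces are uniformly Euclidean carries an equivalent inner
product. -/
theorem exists_innerProductSpaceCore {D : ℝ}
    (h : ∀ E : Submodule ℝ X, FiniteDimensional ℝ E → EuclideanDistortionLE D E) :
    ∃ c : InnerProductSpace.Core ℝ X,
      ∀ x, ‖x‖ ^ 2 ≤ c.inner x x ∧ c.inner x x ≤ D ^ 2 * ‖x‖ ^ 2 := by
  have hext (s : Finset X) : ∃ (m : ℕ) (g : X →ₗ[ℝ] EuclideanSpace ℝ (Fin m)),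
      ∀ x ∈ s, ‖x‖ ≤ ‖g x‖ ∧ ‖g x‖ ≤ D * ‖x‖ := by
    obtain ⟨m, T, hT⟩ := h (Submodule.span ℝ (s : Set X)) (FiniteDimensional.span_finset ℝ s)
    obtain ⟨g, rfl⟩ := T.exists_extend
    exact ⟨m, g, fun x hx ↦ hT ⟨x, Submodule.subset_span hx⟩⟩
  choose m g hg using hext
  let U : Ultrafilter (Finset X) := Ultrafilter.of Filter.atTop
  have hU (x : X) : ∀ᶠ s in (U : Filter (Finset X)), ‖x‖ ≤ ‖g s x‖ ∧ ‖g s x‖ ≤ D * ‖x‖ := by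
    refine Ultrafilter.of_le Filter.atTop ?_
    filter_upwards [Filter.eventually_ge_atTop {x}] with s hs
    exact hg s x (hs (Finset.mem_singleton_self x))
  have hlim (x y : X) : ∃ b : ℝ,
      Filter.Tendsto (fun s ↦ ⟪g s x, g s y⟫) U (nhds b) := by
    have hmem : Set.Icc (-(D * ‖x‖ * (D * ‖y‖))) (D * ‖x‖ * (D * ‖y‖)) ∈
        U.map (fun s ↦ ⟪g s x, g s y⟫) := by
      change ∀ᶠ s in (U : Filter (Finset X)), ⟪g s x, g s y⟫ ∈ _
      filter_upwards [hU x, hU y] with s hx hy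
      refine abs_le.1 ((abs_real_inner_le_norm _ _).trans ?_)
      exact mul_le_mul hx.2 hy.2 (norm_nonneg _) ((norm_nonneg _).trans hx.2)
    obtain ⟨b, -, hb⟩ := isCompact_Icc.ultrafilter_le_nhds' _ hmem
    exact ⟨b, hb⟩
  choose b hb using hlim
  have hbound (x : X) : ‖x‖ ^ 2 ≤ b x x ∧ b x x ≤ D ^ 2 * ‖x‖ ^ 2 := by
    constructor
    · refine ge_of_tendsto (hb x x) ?_
      filter_upwards [hU x] with s hs
      rw [real_inner_self_eq_norm_sq]
      exact pow_le_pow_left₀ (norm_nonneg _) hs.1 2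
    · refine le_of_tendsto (hb x x) ?_
      filter_upwards [hU x] with s hs
      rw [real_inner_self_eq_norm_sq, ← mul_pow]
      exact pow_le_pow_left₀ (norm_nonneg _) hs.2 2
  refine ⟨{ inner := b
            conj_inner_symm := fun x y ↦ ?_
            re_inner_nonneg := fun x ↦ (sq_nonneg _).trans (hbound x).1
            add_left := fun x y z ↦ ?_
            smul_left := fun x y r ↦ ?_
            definite := fun x hx ↦ ?_ }, hbound⟩
  · refine tendsto_nhds_unique (hb y x) ((hb x y).congr fun s ↦ ?_)
    exact real_inner_comm _ _
  · refine tendsto_nhds_unique (hb (x + y) z) (((hb x z).add (hb y z)).congr fun s ↦ ?_)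
    rw [map_add, inner_add_left]
  · refine tendsto_nhds_unique (hb (r • x) y) (((hb x y).const_mul r).congr fun s ↦ ?_)
    rw [map_smul, real_inner_smul_left]
  · have h1 := (hbound x).1
    change b x x = 0 at hx
    rw [hx] at h1
    exact norm_eq_zero.1 (pow_eq_zero_iff two_ne_zero |>.1 (le_antisymm h1 (sq_nonneg _)))

end UltraproductForm

theorem exists_hilbert_of_linearEquiv {X : Type*} {V : Type u} [NormedAddCommGroup X] [NormedSpace ℝ X]
    [CompleteSpace X] [AddCommGroup V] [Module ℝ V] (c : InnerProductSpace.Core ℝ V)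
    (e : X ≃ₗ[ℝ] V) {D : ℝ}
    (h : ∀ x, ‖x‖ ^ 2 ≤ c.inner (e x) (e x) ∧ c.inner (e x) (e x) ≤ D ^ 2 * ‖x‖ ^ 2) :
    ∃ (H : Type u) (_ : NormedAddCommGroup H) (_ : InnerProductSpace ℝ H)
      (_ : CompleteSpace H), Nonempty (X ≃L[ℝ] H) := by
  let : NormedAddCommGroup V := c.toNormedAddCommGroup
  let : InnerProductSpace ℝ V := InnerProductSpace.ofCore c.toCore
  have hn (v : V) : ‖v‖ ^ 2 = c.inner v v := (real_inner_self_eq_norm_sq v).symm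
  let e' : X ≃L[ℝ] V := e.toContinuousLinearEquivOfBounds |D| 1
    (fun x ↦ by
      refine le_of_sq_le_sq ?_ (by positivity)
      rw [hn, mul_pow, sq_abs]
      exact (h x).2)
    (fun v ↦ by
      refine le_of_sq_le_sq ?_ (by positivity)
      rw [one_mul, hn]
      simpa using (h (e.symm v)).1)
  refine ⟨V, inferInstance, inferInstance, ?_, ⟨e'⟩⟩
  exact (completeSpace_congr (e := e'.toEquiv) e'.isUniformEmbedding).1 inferInstance

end

/-- If `X` is an infinite-dimensional Banach space in which every closed subspace is
locally complemented, then `X` is isomorphic to a Hilbert space.  (Theorem 4.4.) -/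
theorem isomorphic_to_hilbert_of_all_subspaces_locally_complemented
    {X : Type u} [NormedAddCommGroup X] [NormedSpace ℝ X] [CompleteSpace X]
    (hinf : ¬ FiniteDimensional ℝ X)
    (h : ∀ Y : Submodule ℝ X, IsClosed (Y : Set X) →
      ∃ lam : ℝ, ∀ F : Submodule ℝ X, FiniteDimensional ℝ F →
        ∃ r : F →L[ℝ] Y, ‖r‖ ≤ lam ∧ ∀ (y : Y) (hy : (y : X) ∈ F), r ⟨(y : X), hy⟩ = y) :
    ∃ (H : Type u) (_ : NormedAddCommGroup H) (_ : InnerProductSpace ℝ H)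
      (_ : CompleteSpace H), Nonempty (X ≃L[ℝ] H) := by
  obtain ⟨D, hD⟩ := exists_uniform_euclideanDistortionLE hinf h
  obtain ⟨c, hc⟩ := exists_innerProductSpaceCore hD
  exact exists_hilbert_of_linearEquiv c (LinearEquiv.refl ℝ X) hc
end
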